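/- arXiv:2511.06784 — 7 statements merged into one kernel-verified Lean document; each statement's English description precedes it below -/
import Mathlib

section
/- Let k ≥ 3 and d ≥ 3 be integers, and let π_1, …, π_k be k nontrivial partitions of d satisfying ∑_{i=1}^{k} (d − |π_i|) = 2d − 2 and |π_i| ≥ |π_k| for all i, with k ≥ |π_k| + 2. Then for any two indices i ≠ j in {1, …, k}, the collection of three partitions of (k−2)d consisting of: (a) the partition obtained by concatenating (taking the multiset union of the parts of) all π_l with l ∉ {i, j}; (b) the partition (k−2)π_i whose parts are (k−2)·a for each part a of π_i; and (c) the partition (k−2)π_j whose parts are (k−2)·a for each part a of π_j, is realizable as the branch datum of a degree (k−2)d branched covering S² → S². -/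
/-- The cycle type of a permutation of `Fin d`, counting fixed points as parts equal to `1`. -/
def fullCycleType {d : ℕ} (σ : Equiv.Perm (Fin d)) : Multiset ℕ :=
  σ.cycleType + Multiset.replicate (d - σ.cycleType.sum) 1

/-- Realizability of a collection of partitions of `d` as the branch datum of a degree `d`
branched covering `S² → S²`, via Hurwitz's theorem. -/
def realizable (d k : ℕ) (π : Fin k → Multiset ℕ) : Prop :=
  ∃ α : Fin k → Equiv.Perm (Fin d),
    (∀ i, fullCycleType (α i) = π i) ∧
    (List.ofFn α).prod = 1 ∧
    ∀ x y : Fin d, ∃ g ∈ Subgroup.closure (Set.range α), g x = y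

namespace Hurwitz

open Equiv Equiv.Perm Finset

/-- The number of points in the cycle of `σ` through `x`. -/
noncomputable def cyc {X : Type} (σ : Perm X) (x : X) : ℕ := Nat.card {y // σ.SameCycle x y}

/-- The multiset of cycle lengths of a permutation, fixed points included. -/
noncomputable def ctype {X : Type} [Fintype X] (σ : Perm X) : Multiset ℕ :=
  letI := Fintype.ofFinite (Quotient (SameCycle.setoid σ))
  (univ : Finset (Quotient (SameCycle.setoid σ))).val.map
    (fun c => Nat.card {x // Quotient.mk (SameCycle.setoid σ) x = c})

@[simp]
theorem sameCycle_self {X : Type} (σ : Perm X) (x : X) : σ.SameCycle x x := SameCycle.refl _ _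

theorem ctype_eq_of_label {X ι : Type} [Fintype X] [Fintype ι] (σ : Perm X) (f : X → ι)
    (hf : Function.Surjective f) (h : ∀ x y, σ.SameCycle x y ↔ f x = f y) :
    ctype σ = (univ : Finset ι).val.map (fun i => Nat.card {x // f x = i}) := by
  let _ := Fintype.ofFinite (Quotient (SameCycle.setoid σ))
  let g : Quotient (SameCycle.setoid σ) → ι :=
    Quotient.lift f (fun x y hxy => (h x y).1 hxy)
  have hg : Function.Bijective g := by
    constructor
    · rintro ⟨x⟩ ⟨y⟩ hxy
      exact Quotient.sound ((h x y).2 hxy)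
    · intro i
      obtain ⟨x, rfl⟩ := hf i
      exact ⟨Quotient.mk _ x, rfl⟩
  rw [← Multiset.map_univ_val_equiv (Equiv.ofBijective g hg), Multiset.map_map]
  unfold ctype
  congr 1
  funext c
  apply Nat.card_congr
  apply Equiv.subtypeEquivRight
  intro x
  change _ ↔ f x = g c
  rw [← hg.1.eq_iff]
  rfl

theorem exists_label {X : Type} [Fintype X] (σ : Perm X) :
    ∃ (ι : Type) (_ : Fintype ι) (f : X → ι), Function.Surjective f ∧
      ∀ x y, σ.SameCycle x y ↔ f x = f y :=
  ⟨Quotient (SameCycle.setoid σ), Fintype.ofFinite _, Quotient.mk _,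
    Quotient.mk_surjective, fun _ _ => ⟨fun h => Quotient.sound h, fun h => Quotient.exact h⟩⟩

theorem cyc_eq_of_label {X ι : Type} (σ : Perm X) (f : X → ι)
    (h : ∀ x y, σ.SameCycle x y ↔ f x = f y) (x : X) : cyc σ x = Nat.card {y // f y = f x} := by
  apply Nat.card_congr
  apply Equiv.subtypeEquivRight
  intro y
  rw [h, eq_comm]

theorem ctype_sum {X : Type} [Fintype X] (σ : Perm X) : (ctype σ).sum = Fintype.card X := by
  classical
  obtain ⟨ι, _, f, hf, h⟩ := exists_label σ
  rw [ctype_eq_of_label σ f hf h, ← Fintype.card_congr (Equiv.sigmaFiberEquiv f),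
    Fintype.card_sigma]
  simp only [Nat.card_eq_fintype_card]
  rfl

theorem ctype_pos {X : Type} [Fintype X] (σ : Perm X) : ∀ a ∈ ctype σ, 1 ≤ a := by
  classical
  obtain ⟨ι, _, f, hf, h⟩ := exists_label σ
  rw [ctype_eq_of_label σ f hf h]
  intro a ha
  rw [Multiset.mem_map] at ha
  obtain ⟨i, -, rfl⟩ := ha
  obtain ⟨x, hx⟩ := hf i
  have : Nonempty {x // f x = i} := ⟨⟨x, hx⟩⟩
  exact Nat.card_pos

theorem _root_.Equiv.Perm.SameCycle.cyc_eq {X : Type} {σ : Perm X} {x y : X} (h : σ.SameCycle x y) :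
    cyc σ x = cyc σ y := by
  apply Nat.card_congr
  apply Equiv.subtypeEquivRight
  intro z
  exact ⟨fun h' => h.symm.trans h', fun h' => h.trans h'⟩

theorem ctype_eq_cons {X : Type} [Fintype X] (σ : Perm X) (x : X) :
    ∃ R, ctype σ = cyc σ x ::ₘ R := by
  classical
  obtain ⟨ι, _, f, hf, h⟩ := exists_label σ
  rw [ctype_eq_of_label σ f hf h, cyc_eq_of_label σ f h]
  apply Multiset.exists_cons_of_mem
  rw [Multiset.mem_map]
  exact ⟨f x, by simp, rfl⟩

theorem exists_cyc_eq {X : Type} [Fintype X] (σ : Perm X) {c : ℕ} (hc : c ∈ ctype σ) :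
    ∃ x, cyc σ x = c := by
  classical
  obtain ⟨ι, _, f, hf, h⟩ := exists_label σ
  rw [ctype_eq_of_label σ f hf h, Multiset.mem_map] at hc
  obtain ⟨i, -, rfl⟩ := hc
  obtain ⟨x, rfl⟩ := hf i
  exact ⟨x, cyc_eq_of_label σ f h x⟩

theorem cyc_eq_card_support {X : Type} [Fintype X] [DecidableEq X] (σ : Perm X) {x : X}
    (hx : σ x ≠ x) : #(σ.cycleOf x).support = cyc σ x := by
  unfold cyc
  rw [Nat.card_eq_fintype_card, Fintype.card_subtype]
  congr 1
  ext y
  simp [mem_support_cycleOf_iff' hx]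

theorem cyc_eq_one_iff {X : Type} [Fintype X] (σ : Perm X) (x : X) :
    cyc σ x = 1 ↔ σ x = x := by
  unfold cyc
  rw [Nat.card_eq_one_iff_unique]
  constructor
  · rintro ⟨h, -⟩
    have := h.elim ⟨x, SameCycle.refl _ _⟩ ⟨σ x, sameCycle_apply_right.2 (SameCycle.refl _ _)⟩
    simpa using this.symm
  · intro h
    refine ⟨⟨?_⟩, ⟨⟨x, SameCycle.refl _ _⟩⟩⟩
    rintro ⟨y, hy⟩ ⟨z, hz⟩
    have key : ∀ y, σ.SameCycle x y → y = x := by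
      rintro y ⟨n, rfl⟩
      exact Function.IsFixedPt.perm_zpow h n
    simp [key y hy, key z hz]

theorem ctype_eq_cycleType {X : Type} [Fintype X] [DecidableEq X] (σ : Perm X) :
    ctype σ = σ.cycleType + Multiset.replicate (Fintype.card X - σ.cycleType.sum) 1 := by
  classical
  obtain ⟨ι, _, f, hf, h⟩ := exists_label σ
  have h1 : ctype σ = (ctype σ).filter (· ≠ 1) + (ctype σ).filter (fun a => ¬ a ≠ 1) :=
    (Multiset.filter_add_not _ _).symm
  have h3 : (ctype σ).filter (fun a => ¬ a ≠ 1) =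
      Multiset.replicate (Multiset.card ((ctype σ).filter (fun a => ¬ a ≠ 1))) 1 := by
    rw [Multiset.eq_replicate]
    refine ⟨rfl, fun b hb => ?_⟩
    simpa using (Multiset.mem_filter.1 hb).2
  have h2 : (ctype σ).filter (· ≠ 1) = σ.cycleType := by
    rw [ctype_eq_of_label σ f hf h, Multiset.filter_map, cycleType_def]
    have hfix : ∀ x, Nat.card {y // f y = f x} ≠ 1 ↔ σ x ≠ x := by
      intro x
      rw [← cyc_eq_of_label σ f h, Ne, cyc_eq_one_iff]
    symm
    choose s hs using hf
    refine (Multiset.map_eq_map_of_bij_of_nodup _ _ ?_ ?_ (fun i _ => σ.cycleOf (s i))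
      ?_ ?_ ?_ ?_).symm
    · exact (Finset.nodup univ).filter _
    · exact Finset.nodup _
    · intro i hi
      have := (hfix (s i)).1 (by rw [hs]; exact (Multiset.mem_filter.1 hi).2)
      change _ ∈ σ.cycleFactorsFinset
      rw [cycleOf_mem_cycleFactorsFinset_iff, mem_support]
      exact this
    · intro i hi j hj hij
      have h1 := (hfix (s i)).1 (by rw [hs]; exact (Multiset.mem_filter.1 hi).2)
      have h2 := (hfix (s j)).1 (by rw [hs]; exact (Multiset.mem_filter.1 hj).2)
      have : s j ∈ (σ.cycleOf (s j)).support := (mem_support_cycleOf_iff' h2).2 (SameCycle.refl _ _)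
      rw [← hij, mem_support_cycleOf_iff' h1, h, hs, hs] at this
      exact this
    · intro c hc
      change c ∈ σ.cycleFactorsFinset at hc
      obtain ⟨x, hx⟩ := (mem_cycleFactorsFinset_iff.1 hc).1.nonempty_support
      have hcx := cycle_is_cycleOf hx hc
      have hfx : σ x ≠ x := mem_support.1 (mem_cycleFactorsFinset_support_le hc hx)
      refine ⟨f x, ?_, ?_⟩
      · rw [Multiset.mem_filter]
        exact ⟨by simp, (hfix x).2 hfx⟩
      · rw [hcx]
        exact SameCycle.cycleOf_eq ((h _ _).2 (hs _))
    · intro i hi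
      have h1 := (hfix (s i)).1 (by rw [hs]; exact (Multiset.mem_filter.1 hi).2)
      change _ = #(σ.cycleOf (s i)).support
      rw [cyc_eq_card_support σ h1, cyc_eq_of_label σ f h, hs]
  have h4 := ctype_sum σ
  rw [h1, h3, h2, Multiset.sum_add, Multiset.sum_replicate] at h4
  rw [h1, h3, h2]
  congr 2
  simp at h4 ⊢
  omega

theorem sameCycle_congr {X Y : Type} {σ : Perm X} {τ : Perm Y} (e : X ≃ Y)
    (h : ∀ x, e (σ x) = τ (e x)) (x y : X) : τ.SameCycle (e x) (e y) ↔ σ.SameCycle x y := by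
  have hτ : τ = e.permCongr σ := by
    ext y
    obtain ⟨x, rfl⟩ := e.surjective y
    simp [h]
  have hpow : ∀ n : ℤ, (τ ^ n) (e x) = e ((σ ^ n) x) := by
    intro n
    have : e.permCongr σ ^ n = e.permCongr (σ ^ n) := (map_zpow e.permCongrHom σ n).symm
    rw [hτ, this]
    simp
  simp [SameCycle, hpow]

theorem ctype_congr {X Y : Type} [Fintype X] [Fintype Y] {σ : Perm X} {τ : Perm Y} (e : X ≃ Y)
    (h : ∀ x, e (σ x) = τ (e x)) : ctype σ = ctype τ := by
  obtain ⟨ι, _, f, hf, hl⟩ := exists_label σ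
  rw [ctype_eq_of_label σ f hf hl, ctype_eq_of_label τ (f ∘ e.symm) (hf.comp e.symm.surjective)]
  · congr 1
    funext i
    exact Nat.card_congr (e.subtypeEquiv fun y => by simp)
  · intro x y
    obtain ⟨x, rfl⟩ := e.surjective x
    obtain ⟨y, rfl⟩ := e.surjective y
    simp [sameCycle_congr e h, hl]

theorem ctype_conj {X : Type} [Fintype X] (g σ : Perm X) : ctype (g * σ * g⁻¹) = ctype σ :=
  (ctype_congr g (by simp)).symm

theorem ctype_inv {X : Type} [Fintype X] (σ : Perm X) : ctype σ⁻¹ = ctype σ := by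
  obtain ⟨ι, _, f, hf, hl⟩ := exists_label σ
  rw [ctype_eq_of_label σ f hf hl, ctype_eq_of_label σ⁻¹ f hf]
  simpa using hl

theorem ctype_one {X : Type} [Fintype X] :
    ctype (1 : Perm X) = Multiset.replicate (Fintype.card X) 1 := by
  rw [ctype_eq_of_label 1 id Function.surjective_id (by simp)]
  simp

theorem exists_conj {X Y : Type} [Fintype X] [Fintype Y] {σ : Perm X} {τ : Perm Y}
    (h : ctype σ = ctype τ) : ∃ e : X ≃ Y, ∀ x, e (σ x) = τ (e x) := by
  classical
  have hc : Fintype.card X = Fintype.card Y := by rw [← ctype_sum σ, h, ctype_sum]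
  let e0 := Fintype.equivOfCardEq hc
  have hcyc : (e0.permCongr σ).cycleType = τ.cycleType := by
    have hrec : ∀ {Z : Type} [Fintype Z] (ρ : Perm Z), ρ.cycleType = (ctype ρ).filter (· ≠ 1) := by
      intro Z _ ρ
      rw [ctype_eq_cycleType, Multiset.filter_add, Multiset.filter_eq_self.2,
        Multiset.filter_eq_nil.2, add_zero]
      · intro a ha
        simp [Multiset.eq_of_mem_replicate ha]
      · intro a ha
        have := two_le_of_mem_cycleType ha
        omega
    have h1 : (e0.permCongr σ).cycleType = σ.cycleType := by
      rw [hrec, hrec, ctype_congr e0 (σ := σ) (τ := e0.permCongr σ)]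
      simp
    rw [h1, hrec, h, hrec]
  rw [← isConj_iff_cycleType_eq, isConj_iff] at hcyc
  obtain ⟨g, hg⟩ := hcyc
  refine ⟨e0.trans g, fun x => ?_⟩
  rw [← hg]
  simp [Equiv.permCongr_apply]

theorem sameCycle_le {X : Type} {σ : Perm X} {E : X → X → Prop} (hE : Equivalence E)
    (h : ∀ x, E x (σ x)) {x y : X} (hxy : σ.SameCycle x y) : E x y := by
  have hnat : ∀ (n : ℕ) x, E x ((σ ^ n) x) := by
    intro n
    induction n with
    | zero => intro x; simpa using hE.refl x
    | succ n ih =>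
      intro x
      rw [pow_succ', Perm.mul_apply]
      exact hE.trans (ih x) (h _)
  obtain ⟨n, rfl⟩ := hxy
  obtain ⟨m, rfl | rfl⟩ := n.eq_nat_or_neg
  · simpa using hnat m x
  · have := hnat m ((σ ^ (-(m : ℤ))) x)
    rw [← Perm.mul_apply, zpow_neg, zpow_natCast, mul_inv_cancel, Perm.one_apply] at this
    rw [zpow_neg, zpow_natCast]
    exact hE.symm this

theorem sumCongr_zpow {X Y : Type} (σ : Perm X) (τ : Perm Y) (n : ℤ) :
    (Perm.sumCongr σ τ : Perm (X ⊕ Y)) ^ n = Perm.sumCongr (σ ^ n) (τ ^ n) :=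
  (map_zpow (sumCongrHom X Y) (σ, τ) n).symm

@[simp]
theorem sameCycle_sumCongr_inl {X Y : Type} (σ : Perm X) (τ : Perm Y) (x y : X) :
    SameCycle (Perm.sumCongr σ τ : Perm (X ⊕ Y)) (Sum.inl x) (Sum.inl y) ↔ σ.SameCycle x y := by
  simp [SameCycle, sumCongr_zpow]

@[simp]
theorem sameCycle_sumCongr_inr {X Y : Type} (σ : Perm X) (τ : Perm Y) (x y : Y) :
    SameCycle (Perm.sumCongr σ τ : Perm (X ⊕ Y)) (Sum.inr x) (Sum.inr y) ↔ τ.SameCycle x y := by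
  simp [SameCycle, sumCongr_zpow]

@[simp]
theorem sameCycle_sumCongr_inl_inr {X Y : Type} (σ : Perm X) (τ : Perm Y) (x : X) (y : Y) :
    ¬ SameCycle (Perm.sumCongr σ τ : Perm (X ⊕ Y)) (Sum.inl x) (Sum.inr y) := by
  simp [SameCycle, sumCongr_zpow]

@[simp]
theorem sameCycle_sumCongr_inr_inl {X Y : Type} (σ : Perm X) (τ : Perm Y) (x : X) (y : Y) :
    ¬ SameCycle (Perm.sumCongr σ τ : Perm (X ⊕ Y)) (Sum.inr y) (Sum.inl x) := by
  simp [SameCycle, sumCongr_zpow]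

theorem ctype_sumCongr {X Y : Type} [Fintype X] [Fintype Y] (σ : Perm X) (τ : Perm Y) :
    ctype (Perm.sumCongr σ τ : Perm (X ⊕ Y)) = ctype σ + ctype τ := by
  obtain ⟨ι, _, f, hf, hl⟩ := exists_label σ
  obtain ⟨κ, _, g, hg, hm⟩ := exists_label τ
  rw [ctype_eq_of_label σ f hf hl, ctype_eq_of_label τ g hg hm,
    ctype_eq_of_label _ (Sum.map f g) (Sum.map_surjective.2 ⟨hf, hg⟩)]
  · rw [← Finset.univ_disjSum_univ, Finset.val_disjSum, Multiset.disjSum, Multiset.map_add,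
      Multiset.map_map, Multiset.map_map]
    congr 2
    · funext i
      refine Nat.card_congr (Equiv.ofBijective
        (fun x : {x // f x = i} => ⟨Sum.inl x.1, by simp [x.2]⟩) ⟨?_, ?_⟩).symm
      · intro x y hxy
        simpa [Subtype.ext_iff] using hxy
      · rintro ⟨x | x, hx⟩
        · exact ⟨⟨x, by simpa using hx⟩, rfl⟩
        · simp at hx
    · funext i
      refine Nat.card_congr (Equiv.ofBijective
        (fun x : {x // g x = i} => ⟨Sum.inr x.1, by simp [x.2]⟩) ⟨?_, ?_⟩).symm
      · intro x y hxy
        simpa [Subtype.ext_iff] using hxy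
      · rintro ⟨x | x, hx⟩
        · simp at hx
        · exact ⟨⟨x, by simpa using hx⟩, rfl⟩
  · rintro (x | x) (y | y) <;> simp [hl, hm]

@[simp]
theorem cyc_sumCongr_inl {X Y : Type} (σ : Perm X) (τ : Perm Y) (x : X) :
    cyc (Perm.sumCongr σ τ : Perm (X ⊕ Y)) (Sum.inl x) = cyc σ x := by
  refine (Nat.card_congr (Equiv.ofBijective
        (fun y : {y // σ.SameCycle x y} => ⟨Sum.inl y.1, by simp [y.2]⟩) ⟨?_, ?_⟩)).symm
  · intro x y hxy
    simpa [Subtype.ext_iff] using hxy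
  · rintro ⟨y | y, hy⟩
    · exact ⟨⟨y, by simpa using hy⟩, rfl⟩
    · simp at hy

@[simp]
theorem cyc_sumCongr_inr {X Y : Type} (σ : Perm X) (τ : Perm Y) (x : Y) :
    cyc (Perm.sumCongr σ τ : Perm (X ⊕ Y)) (Sum.inr x) = cyc τ x := by
  refine (Nat.card_congr (Equiv.ofBijective
        (fun y : {y // τ.SameCycle x y} => ⟨Sum.inr y.1, by simp [y.2]⟩) ⟨?_, ?_⟩)).symm
  · intro x y hxy
    simpa [Subtype.ext_iff] using hxy
  · rintro ⟨y | y, hy⟩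
    · simp at hy
    · exact ⟨⟨y, by simpa using hy⟩, rfl⟩

theorem sameCycle_mul_swap {X : Type} [Fintype X] [DecidableEq X] {σ : Perm X} {u v : X}
    (huv : ¬ σ.SameCycle u v) (x y : X) :
    (σ * swap u v).SameCycle x y ↔ σ.SameCycle x y ∨
      (σ.SameCycle u x ∨ σ.SameCycle v x) ∧ (σ.SameCycle u y ∨ σ.SameCycle v y) := by
  have happ : ∀ x, x ≠ u → x ≠ v → (σ * swap u v) x = σ x := by
    intro x h1 h2
    rw [Perm.mul_apply, swap_apply_of_ne_of_ne h1 h2]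
  have hjoin : (σ * swap u v).SameCycle u v := by
    have key : ∀ j : ℕ, (σ * swap u v).SameCycle u v ∨
        (σ * swap u v).SameCycle u ((σ ^ (j + 1)) v) := by
      intro j
      induction j with
      | zero =>
        right
        have : (σ * swap u v) u = (σ ^ (0 + 1)) v := by simp
        rw [← this, sameCycle_apply_right]
      | succ j ih =>
        rcases ih with ih | ih
        · exact Or.inl ih
        · by_cases h1 : (σ ^ (j + 1)) v = v
          · rw [h1] at ih
            exact Or.inl ih
          · right
            have h2 : (σ ^ (j + 1)) v ≠ u := fun h2 =>
              huv (SameCycle.symm ⟨(j + 1 : ℕ), by rw [zpow_natCast]; exact h2⟩)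
            rw [pow_succ', Perm.mul_apply, ← happ _ h2 h1, sameCycle_apply_right]
            exact ih
    have h := key (orderOf σ - 1)
    rw [Nat.sub_add_cancel (orderOf_pos σ), pow_orderOf_eq_one] at h
    simpa using h
  have hle : ∀ {x y}, σ.SameCycle x y → (σ * swap u v).SameCycle x y := by
    intro x y hxy
    refine sameCycle_le (SameCycle.setoid (σ * swap u v)).iseqv ?_ hxy
    intro x
    change (σ * swap u v).SameCycle x (σ x)
    by_cases h1 : x = u
    · subst h1
      have : (σ * swap x v) v = σ x := by simp
      rw [← this, sameCycle_apply_right]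
      exact hjoin
    · by_cases h2 : x = v
      · subst h2
        have : (σ * swap u x) u = σ x := by simp
        rw [← this, sameCycle_apply_right]
        exact hjoin.symm
      · rw [← happ x h1 h2, sameCycle_apply_right]
  constructor
  · intro h
    refine sameCycle_le (E := fun x y => σ.SameCycle x y ∨
      (σ.SameCycle u x ∨ σ.SameCycle v x) ∧ (σ.SameCycle u y ∨ σ.SameCycle v y))
      ⟨?_, ?_, ?_⟩ ?_ h
    · exact fun x => Or.inl (SameCycle.refl _ _)
    · rintro x y (h | h)
      · exact Or.inl h.symm
      · exact Or.inr h.symm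
    · rintro x y z (h | h) (h' | h')
      · exact Or.inl (h.trans h')
      · exact Or.inr ⟨h'.1.imp (fun k => k.trans h.symm) (fun k => k.trans h.symm), h'.2⟩
      · exact Or.inr ⟨h.1, h.2.imp (fun k => k.trans h') (fun k => k.trans h')⟩
      · exact Or.inr ⟨h.1, h'.2⟩
    · intro x
      by_cases h1 : x = u
      · subst h1
        simp
      · by_cases h2 : x = v
        · subst h2
          simp
        · rw [happ x h1 h2]
          simp
  · have hb : ∀ x, σ.SameCycle u x ∨ σ.SameCycle v x → (σ * swap u v).SameCycle u x := by
      rintro x (h | h)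
      · exact hle h
      · exact hjoin.trans (hle h)
    rintro (h | ⟨h1, h2⟩)
    · exact hle h
    · exact (hb x h1).symm.trans (hb y h2)

theorem cyc_mul_swap {X : Type} [Fintype X] [DecidableEq X] {σ : Perm X} {u v : X}
    (huv : ¬ σ.SameCycle u v) : cyc (σ * swap u v) u = cyc σ u + cyc σ v := by
  classical
  unfold cyc
  rw [← Nat.card_sum]
  have hd : Disjoint (fun y => σ.SameCycle u y) (fun y => σ.SameCycle v y) := by
    rw [Pi.disjoint_iff]
    intro y
    rw [disjoint_iff_inf_le]
    rintro ⟨h1, h2⟩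
    exact huv (h1.trans h2.symm)
  rw [← Nat.card_congr (subtypeOrEquiv _ _ hd)]
  apply Nat.card_congr
  apply Equiv.subtypeEquivRight
  intro y
  rw [sameCycle_mul_swap huv]
  simp only [sameCycle_self, true_or, true_and, or_iff_right_iff_imp]
  exact Or.inl

theorem cyc_mul_swap_of_not {X : Type} [Fintype X] [DecidableEq X] {σ : Perm X} {u v x : X}
    (huv : ¬ σ.SameCycle u v) (h1 : ¬ σ.SameCycle u x) (h2 : ¬ σ.SameCycle v x) :
    cyc (σ * swap u v) x = cyc σ x := by
  apply Nat.card_congr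
  apply Equiv.subtypeEquivRight
  intro y
  rw [sameCycle_mul_swap huv]
  tauto

theorem ctype_mul_swap {X : Type} [Fintype X] [DecidableEq X] {σ : Perm X} {u v : X}
    (huv : ¬ σ.SameCycle u v) : ∃ R, ctype σ = cyc σ u ::ₘ cyc σ v ::ₘ R ∧
      ctype (σ * swap u v) = (cyc σ u + cyc σ v) ::ₘ R := by
  classical
  obtain ⟨ι, _, f, hf, hl⟩ := exists_label σ
  have hne : f u ≠ f v := fun h => huv ((hl u v).2 h)
  let f' : X → {i // i ≠ f v} := fun x => if h : f x = f v then ⟨f u, hne⟩ else ⟨f x, h⟩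
  have hf'1 : ∀ x, f x = f v → f' x = ⟨f u, hne⟩ := fun x h => dif_pos h
  have hf'2 : ∀ x (h : f x ≠ f v), f' x = ⟨f x, h⟩ := fun x h => dif_neg h
  have hlab : ∀ x y, (σ * swap u v).SameCycle x y ↔ f' x = f' y := by
    intro x y
    rw [sameCycle_mul_swap huv, hl, hl, hl, hl, hl]
    by_cases hx : f x = f v <;> by_cases hy : f y = f v
    · rw [hf'1 x hx, hf'1 y hy]
      simp [hx, hy]
    · rw [hf'1 x hx, hf'2 y hy]
      simp [hx, Ne.symm hy]
    · rw [hf'2 x hx, hf'1 y hy]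
      simp [hx, hy, Ne.symm hx, eq_comm]
    · rw [hf'2 x hx, hf'2 y hy]
      simp only [Subtype.mk.injEq, Ne.symm hx, Ne.symm hy, or_false]
      constructor
      · rintro (h | ⟨h1, h2⟩)
        · exact h
        · rw [← h1, ← h2]
      · exact Or.inl
  have hsurj : Function.Surjective f' := by
    rintro ⟨i, hi⟩
    obtain ⟨x, rfl⟩ := hf i
    exact ⟨x, hf'2 x hi⟩
  let F : ι → ℕ := fun i => Nat.card {x // f x = i}
  let G : ι → ℕ := fun i => if i = f u then cyc σ u + cyc σ v else F i
  have hG : ∀ i : {i // i ≠ f v}, Nat.card {x // f' x = i} = G i.1 := by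
    rintro ⟨i, hi⟩
    obtain ⟨x, rfl⟩ := hf i
    rw [← hf'2 x hi, ← cyc_eq_of_label _ f' hlab]
    by_cases hxu : f x = f u
    · have h1 : (σ * swap u v).SameCycle x u :=
        (sameCycle_mul_swap huv x u).2 (Or.inl ((hl _ _).2 hxu))
      rw [h1.cyc_eq, cyc_mul_swap huv, hf'2 x hi]
      simp [G, hxu]
    · rw [cyc_mul_swap_of_not huv (by rw [hl]; exact Ne.symm hxu) (by rw [hl]; exact Ne.symm hi),
        hf'2 x hi, cyc_eq_of_label σ f hl]
      simp [G, hxu, F]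
  refine ⟨((univ.erase (f v)).erase (f u)).val.map F, ?_, ?_⟩
  · rw [ctype_eq_of_label σ f hf hl, cyc_eq_of_label σ f hl, cyc_eq_of_label σ f hl]
    have h1 : (univ : Finset ι).val = f u ::ₘ f v ::ₘ ((univ.erase (f v)).erase (f u)).val := by
      rw [Multiset.cons_swap, ← Finset.insert_val_of_notMem (notMem_erase _ _),
        Finset.insert_erase (mem_erase.2 ⟨hne, mem_univ _⟩),
        ← Finset.insert_val_of_notMem (notMem_erase _ _), Finset.insert_erase (mem_univ _)]
    rw [h1, Multiset.map_cons, Multiset.map_cons]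
  · rw [ctype_eq_of_label _ f' hsurj hlab]
    simp only [hG]
    have h2 : (univ : Finset {i // i ≠ f v}).val.map (fun i => G i.1) =
        (univ.erase (f v)).val.map G := by
      have h3 : (univ : Finset {i // i ≠ f v}).map (Function.Embedding.subtype _) =
          univ.erase (f v) := by
        ext i
        simp
      rw [← h3, Finset.map_val, Multiset.map_map]
      rfl
    rw [h2, ← Finset.insert_erase (mem_erase.2 ⟨hne, mem_univ (f u)⟩),
      Finset.insert_val_of_notMem (notMem_erase _ _), Multiset.map_cons]
    congr 1
    · simp [G]
    · rw [Finset.erase_insert (notMem_erase _ _)]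
      apply Multiset.map_congr rfl
      intro i hi
      have : i ≠ f u := ne_of_mem_erase hi
      simp [G, this]

/-! ### Multiplying by a transposition on the left -/

theorem swap_mul_eq {X : Type} [DecidableEq X] (σ : Perm X) (u v : X) :
    swap u v * σ = σ * swap (σ⁻¹ u) (σ⁻¹ v) := by
  rw [mul_swap_eq_swap_mul]
  simp

theorem not_sameCycle_inv {X : Type} {σ : Perm X} {u v : X} (huv : ¬ σ.SameCycle u v) :
    ¬ σ.SameCycle (σ⁻¹ u) (σ⁻¹ v) := by
  simpa using huv

theorem sameCycle_swap_mul {X : Type} [Fintype X] [DecidableEq X] {σ : Perm X} {u v : X}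
    (huv : ¬ σ.SameCycle u v) (x y : X) :
    (swap u v * σ).SameCycle x y ↔ σ.SameCycle x y ∨
      (σ.SameCycle u x ∨ σ.SameCycle v x) ∧ (σ.SameCycle u y ∨ σ.SameCycle v y) := by
  rw [swap_mul_eq, sameCycle_mul_swap (not_sameCycle_inv huv)]
  simp

theorem cyc_inv_apply {X : Type} (σ : Perm X) (x : X) : cyc σ (σ⁻¹ x) = cyc σ x :=
  SameCycle.cyc_eq (by simp)

theorem cyc_swap_mul {X : Type} [Fintype X] [DecidableEq X] {σ : Perm X} {u v : X}
    (huv : ¬ σ.SameCycle u v) : cyc (swap u v * σ) u = cyc σ u + cyc σ v := by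
  have h : (swap u v * σ).SameCycle u (σ⁻¹ u) := by
    rw [sameCycle_swap_mul huv]
    simp
  rw [h.cyc_eq, swap_mul_eq, cyc_mul_swap (not_sameCycle_inv huv), cyc_inv_apply, cyc_inv_apply]

theorem ctype_swap_mul {X : Type} [Fintype X] [DecidableEq X] {σ : Perm X} {u v : X}
    (huv : ¬ σ.SameCycle u v) : ∃ R, ctype σ = cyc σ u ::ₘ cyc σ v ::ₘ R ∧
      ctype (swap u v * σ) = (cyc σ u + cyc σ v) ::ₘ R := by
  rw [swap_mul_eq, ← cyc_inv_apply σ u, ← cyc_inv_apply σ v]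
  exact ctype_mul_swap (not_sameCycle_inv huv)

theorem ctype_mul_swap_eq {X : Type} [Fintype X] [DecidableEq X] {σ : Perm X} {u v : X}
    (huv : ¬ σ.SameCycle u v) {R : Multiset ℕ} (h : ctype σ = cyc σ u ::ₘ cyc σ v ::ₘ R) :
    ctype (σ * swap u v) = (cyc σ u + cyc σ v) ::ₘ R := by
  obtain ⟨R', h1, h2⟩ := ctype_mul_swap huv
  rw [h, Multiset.cons_inj_right, Multiset.cons_inj_right] at h1
  rw [h2, h1]

theorem ctype_swap_mul_eq {X : Type} [Fintype X] [DecidableEq X] {σ : Perm X} {u v : X}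
    (huv : ¬ σ.SameCycle u v) {R : Multiset ℕ} (h : ctype σ = cyc σ u ::ₘ cyc σ v ::ₘ R) :
    ctype (swap u v * σ) = (cyc σ u + cyc σ v) ::ₘ R := by
  obtain ⟨R', h1, h2⟩ := ctype_swap_mul huv
  rw [h, Multiset.cons_inj_right, Multiset.cons_inj_right] at h1
  rw [h2, h1]

theorem add_singleton_eq_cons (s : Multiset ℕ) (a : ℕ) : s + {a} = a ::ₘ s := by
  rw [add_comm, Multiset.singleton_add]

theorem sumCongr_mul_one {X Y : Type} (a q : Perm X) (s : Perm Y) :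
    (Perm.sumCongr a 1 : Perm (X ⊕ Y)) * Perm.sumCongr q s = Perm.sumCongr (a * q) s := by
  rw [Perm.sumCongr_mul, one_mul]

@[simp]
theorem cyc_one {X : Type} [Fintype X] (x : X) : cyc (1 : Perm X) x = 1 :=
  (cyc_eq_one_iff _ _).2 rfl

theorem cyc_eq_card {X : Type} [Fintype X] {ρ : Perm X} (h : ∀ x y, ρ.SameCycle x y) (x : X) :
    cyc ρ x = Fintype.card X := by
  rw [cyc, Nat.card_congr (Equiv.subtypeUnivEquiv (h x)), Nat.card_eq_fintype_card]

theorem ctype_eq_singleton {X : Type} [Fintype X] [Nonempty X] {ρ : Perm X}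
    (h : ∀ x y, ρ.SameCycle x y) : ctype ρ = {Fintype.card X} := by
  rw [ctype_eq_of_label ρ (fun _ => ()) (fun _ => (⟨Classical.arbitrary X, rfl⟩ : ∃ _, _ = _))
    (by simpa using h)]
  simp

open scoped Fin.NatCast in
theorem exists_cycle {c : ℕ} (hc : 1 ≤ c) :
    ∃ ρ : Perm (Fin c), (∀ x y, ρ.SameCycle x y) ∧ ctype ρ = {c} := by
  obtain ⟨n, rfl⟩ : ∃ n, c = n + 1 := ⟨c - 1, by omega⟩
  have h : ∀ x y : Fin (n + 1), SameCycle (Equiv.addRight (1 : Fin (n + 1))) x y := by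
    intro x y
    have key : ∀ (k : ℕ) (x : Fin (n + 1)),
        (((Equiv.addRight (1 : Fin (n + 1))) ^ k : Perm (Fin (n + 1))) x : Fin (n + 1)) =
          x + (k : Fin (n + 1)) := by
      intro k
      induction k with
      | zero => simp
      | succ k ih => intro x; rw [pow_succ', Perm.mul_apply, ih]; simp [add_assoc]
    refine ⟨((y - x : Fin (n + 1)) : ℕ), ?_⟩
    rw [zpow_natCast, key]
    simp
  exact ⟨_, h, by simpa using ctype_eq_singleton h⟩

theorem ctype_eq_singleton_iff {X : Type} [Fintype X] {ρ : Perm X} {c : ℕ}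
    (h : ctype ρ = {c}) (x y : X) : ρ.SameCycle x y := by
  obtain ⟨R, hR⟩ := ctype_eq_cons ρ x
  obtain ⟨ι, _, f, hf, hl⟩ := exists_label ρ
  rw [hl]
  rw [ctype_eq_of_label ρ f hf hl] at h
  have := congrArg Multiset.card h
  rw [Multiset.card_map, Multiset.card_singleton] at this
  have h2 : Fintype.card ι = 1 := this
  exact (Fintype.card_le_one_iff_subsingleton.1 h2.le).elim _ _

/-- There are permutations `a`, `q` with `a` of type `A`, `a * q` of type `T` and `q` of type
`C ::ₘ cs`, such that every cycle of `a * q` meets the distinguished cycle of `q` of length `C`. -/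
def Tri (A T cs : Multiset ℕ) : Prop :=
  ∃ (X : Type) (_ : Fintype X) (a q : Perm X) (z : X), ctype a = A ∧ ctype (a * q) = T ∧
    ctype q = cyc q z ::ₘ cs ∧ ∀ x, ∃ y, (a * q).SameCycle x y ∧ q.SameCycle z y

/-- A version of `Tri` where the lengths `α` and `p` of the cycles of `a` and `a * q` through the
base point are recorded. -/
def PTri (A : Multiset ℕ) (α : ℕ) (T : Multiset ℕ) (p : ℕ) (cs : Multiset ℕ) : Prop :=
  ∃ (X : Type) (_ : Fintype X) (a q : Perm X) (z : X), ctype a = α ::ₘ A ∧ cyc a z = α ∧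
    ctype (a * q) = p ::ₘ T ∧ cyc (a * q) z = p ∧
    ctype q = cyc q z ::ₘ cs ∧ ∀ x, ∃ y, (a * q).SameCycle x y ∧ q.SameCycle z y

theorem Tri.base : Tri {1} {1} 0 := by
  refine ⟨Unit, inferInstance, 1, 1, (), ?_, ?_, ?_, ?_⟩
  · simp [ctype_one]
  · simp [ctype_one]
  · simp [ctype_one]
  · simp

theorem PTri.forget {A : Multiset ℕ} {α : ℕ} {T : Multiset ℕ} {p : ℕ} {cs : Multiset ℕ}
    (h : PTri A α T p cs) : Tri (α ::ₘ A) (p ::ₘ T) cs := by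
  obtain ⟨X, _, a, q, z, h1, -, h2, -, h3, h4⟩ := h
  exact ⟨X, _, a, q, z, h1, h2, h3, h4⟩

theorem Tri.start {A T cs : Multiset ℕ} {p : ℕ} (h : Tri A (p ::ₘ T) cs) :
    PTri A 1 T (p + 1) cs := by
  classical
  obtain ⟨X, _, a, q, z, h1, h2, h3, h4⟩ := h
  obtain ⟨x, hx⟩ := exists_cyc_eq (a * q) (c := p) (by rw [h2]; simp)
  obtain ⟨y, hxy, hzy⟩ := h4 x
  rw [hxy.cyc_eq] at hx
  have e : (Perm.sumCongr a 1 : Perm (X ⊕ Unit)) *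
      (Perm.sumCongr q 1 * swap (Sum.inr ()) (Sum.inl y)) =
      Perm.sumCongr (a * q) 1 * swap (Sum.inr ()) (Sum.inl y) := by
    rw [← mul_assoc, sumCongr_mul_one]
  refine ⟨X ⊕ Unit, inferInstance, Perm.sumCongr a 1,
    Perm.sumCongr q 1 * swap (Sum.inr ()) (Sum.inl y), Sum.inr (), ?_, ?_, ?_, ?_, ?_, ?_⟩
  · rw [ctype_sumCongr, h1, ctype_one]
    simp [add_singleton_eq_cons]
  · simp
  · rw [e, ctype_mul_swap_eq (R := T) (by simp)]
    · simp [hx, add_comm]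
    · rw [ctype_sumCongr, h2, ctype_one]
      simp [hx, add_singleton_eq_cons, Multiset.cons_swap]
  · rw [e, cyc_mul_swap (by simp)]
    simp [hx, add_comm]
  · rw [cyc_mul_swap (by simp), ctype_mul_swap_eq (R := cs) (by simp)]
    rw [ctype_sumCongr, h3, ctype_one]
    simp [add_singleton_eq_cons, hzy.cyc_eq, Multiset.cons_swap]
  · rw [e]
    rintro (x | ⟨⟩)
    · obtain ⟨w, hw1, hw2⟩ := h4 x
      refine ⟨Sum.inl w, ?_, ?_⟩
      · rw [sameCycle_mul_swap (by simp)]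
        simp [hw1]
      · rw [sameCycle_mul_swap (by simp)]
        simp [hzy.symm.trans hw2]
    · exact ⟨Sum.inr (), by simp, by simp⟩

theorem PTri.leaf {A : Multiset ℕ} {α : ℕ} {T : Multiset ℕ} {p : ℕ} {cs : Multiset ℕ}
    (h : PTri A α T p cs) : PTri A (α + 1) (1 ::ₘ T) p cs := by
  classical
  obtain ⟨X, _, a, q, z, h1, h1', h2, h2', h3, h4⟩ := h
  have e : (Perm.sumCongr a 1 * swap (Sum.inl z) (Sum.inr ()) : Perm (X ⊕ Unit)) *
      (swap (Sum.inl z) (Sum.inr ()) * Perm.sumCongr q 1) = Perm.sumCongr (a * q) 1 := by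
    rw [mul_assoc, ← mul_assoc (swap _ _), swap_mul_self, one_mul, sumCongr_mul_one]
  refine ⟨X ⊕ Unit, inferInstance, Perm.sumCongr a 1 * swap (Sum.inl z) (Sum.inr ()),
    swap (Sum.inl z) (Sum.inr ()) * Perm.sumCongr q 1, Sum.inl z, ?_, ?_, ?_, ?_, ?_, ?_⟩
  · rw [ctype_mul_swap_eq (R := A) (by simp)]
    · simp [h1']
    · rw [ctype_sumCongr, h1, ctype_one]
      simp [h1', add_singleton_eq_cons]
  · rw [cyc_mul_swap (by simp)]
    simp [h1']
  · rw [e, ctype_sumCongr, h2, ctype_one]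
    simp [add_singleton_eq_cons]
  · rw [e]
    simp [h2']
  · rw [cyc_swap_mul (by simp), ctype_swap_mul_eq (R := cs) (by simp)]
    rw [ctype_sumCongr, h3, ctype_one]
    simp [add_singleton_eq_cons]
  · rw [e]
    rintro (x | ⟨⟩)
    · obtain ⟨w, hw1, hw2⟩ := h4 x
      refine ⟨Sum.inl w, by simpa using hw1, ?_⟩
      rw [sameCycle_swap_mul (by simp)]
      simp [hw2]
    · refine ⟨Sum.inr (), by simp, ?_⟩
      rw [sameCycle_swap_mul (by simp)]
      simp

theorem PTri.addc {A : Multiset ℕ} {α : ℕ} {T : Multiset ℕ} {p : ℕ} {cs : Multiset ℕ}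
    (h : PTri A α T p cs) {c : ℕ} (hc : 1 ≤ c) :
    PTri (A + Multiset.replicate (c - 1) 1) (α + 1) T (p + c) (c ::ₘ cs) := by
  classical
  obtain ⟨X, _, a, q, z, h1, h1', h2, h2', h3, h4⟩ := h
  obtain ⟨ρ, hρ, hρ'⟩ := exists_cycle hc
  let o : Fin c := ⟨0, hc⟩
  have e : (swap (Sum.inl z) (Sum.inr o) * Perm.sumCongr a 1 : Perm (X ⊕ Fin c)) *
      Perm.sumCongr q ρ = swap (Sum.inl z) (Sum.inr o) * Perm.sumCongr (a * q) ρ := by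
    rw [mul_assoc, sumCongr_mul_one]
  refine ⟨X ⊕ Fin c, inferInstance, swap (Sum.inl z) (Sum.inr o) * Perm.sumCongr a 1,
    Perm.sumCongr q ρ, Sum.inl z, ?_, ?_, ?_, ?_, ?_, ?_⟩
  · rw [ctype_swap_mul_eq (R := A + Multiset.replicate (c - 1) 1) (by simp)]
    · simp [h1']
    · obtain ⟨n, rfl⟩ : ∃ n, c = n + 1 := ⟨c - 1, by omega⟩
      rw [ctype_sumCongr, h1, ctype_one]
      simp [h1', Multiset.replicate_succ, Multiset.cons_swap]
  · rw [cyc_swap_mul (by simp)]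
    simp [h1']
  · rw [e, ctype_swap_mul_eq (R := T) (by simp)]
    · simp [h2', cyc_eq_card hρ]
    · rw [ctype_sumCongr, h2, hρ']
      simp [h2', cyc_eq_card hρ, add_singleton_eq_cons]
  · rw [e, cyc_swap_mul (by simp)]
    simp [h2', cyc_eq_card hρ]
  · rw [ctype_sumCongr, h3, hρ', cyc_sumCongr_inl]
    rw [Multiset.cons_add, add_comm cs, Multiset.singleton_add]
  · rw [e]
    rintro (x | x)
    · obtain ⟨w, hw1, hw2⟩ := h4 x
      refine ⟨Sum.inl w, ?_, by simpa using hw2⟩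
      rw [sameCycle_swap_mul (by simp)]
      simp [hw1]
    · refine ⟨Sum.inl z, ?_, by simp⟩
      rw [sameCycle_swap_mul (by simp)]
      simp [hρ]

/-- The excess `∑ (a - 1)` over the parts `a` of `s`. -/
def excess (s : Multiset ℕ) : ℕ := (s.map (· - 1)).sum

@[simp] theorem excess_zero : excess 0 = 0 := rfl

@[simp] theorem excess_cons (a : ℕ) (s : Multiset ℕ) : excess (a ::ₘ s) = (a - 1) + excess s := by
  simp [excess]

@[simp] theorem excess_add (s t : Multiset ℕ) : excess (s + t) = excess s + excess t := by
  simp [excess]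

@[simp] theorem excess_replicate_one (n : ℕ) : excess (Multiset.replicate n 1) = 0 := by
  simp [excess]

theorem excess_add_card {s : Multiset ℕ} (h : ∀ a ∈ s, 1 ≤ a) :
    excess s + Multiset.card s = s.sum := by
  induction s using Multiset.induction_on with
  | empty => simp
  | cons a s ih =>
    have := ih fun b hb => h b (Multiset.mem_cons_of_mem hb)
    have := h a (Multiset.mem_cons_self a s)
    simp only [excess_cons, Multiset.card_cons, Multiset.sum_cons]
    omega

theorem card_mul_le_sum {s : Multiset ℕ} {c : ℕ} (h : ∀ a ∈ s, c ≤ a) :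
    Multiset.card s * c ≤ s.sum := by
  simpa using Multiset.card_nsmul_le_sum (s := s) (a := c) h

theorem sum_le_card_mul {s : Multiset ℕ} {c : ℕ} (h : ∀ a ∈ s, a ≤ c) :
    s.sum ≤ Multiset.card s * c := by
  simpa using Multiset.sum_le_card_nsmul s c h

theorem exists_sub_card {s : Multiset ℕ} {n : ℕ} (h : n ≤ Multiset.card s) :
    ∃ t u, s = t + u ∧ Multiset.card t = n := by
  refine ⟨((s.toList.take n : List ℕ) : Multiset ℕ), ((s.toList.drop n : List ℕ) : Multiset ℕ),
    ?_, ?_⟩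
  · rw [Multiset.coe_add, List.take_append_drop, Multiset.coe_toList]
  · simpa using h

theorem PTri.leaves {A : Multiset ℕ} {α : ℕ} {T : Multiset ℕ} {p : ℕ} {cs : Multiset ℕ}
    (h : PTri A α T p cs) (n : ℕ) : PTri A (α + n) (Multiset.replicate n 1 + T) p cs := by
  induction n with
  | zero => simpa using h
  | succ n ih => simpa [Multiset.replicate_succ, add_assoc] using ih.leaf

theorem PTri.addcs {A : Multiset ℕ} {α : ℕ} {T : Multiset ℕ} {p : ℕ} {cs : Multiset ℕ}
    (h : PTri A α T p cs) (s : Multiset ℕ) (hs : ∀ c ∈ s, 1 ≤ c) :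
    PTri (A + Multiset.replicate (excess s) 1) (α + Multiset.card s) T (p + s.sum) (cs + s) := by
  induction s using Multiset.induction_on with
  | empty => simpa using h
  | cons c s ih =>
    have h1 := (ih fun b hb => hs b (Multiset.mem_cons_of_mem hb)).addc
      (hs c (Multiset.mem_cons_self c s))
    convert h1 using 1
    · rw [add_assoc, ← Multiset.replicate_add, excess_cons, add_comm (c - 1)]
    · simp [add_assoc]
    · simp only [Multiset.sum_cons]; omega
    · simp

theorem Tri.bundle {A T cs : Multiset ℕ} {p : ℕ} (h : Tri A (p ::ₘ T) cs) (n : ℕ)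
    (s : Multiset ℕ) (hs : ∀ c ∈ s, 1 ≤ c) :
    Tri ((1 + n + Multiset.card s) ::ₘ (A + Multiset.replicate (excess s) 1))
      ((p + 1 + s.sum) ::ₘ (Multiset.replicate n 1 + T)) (cs + s) :=
  ((h.start.leaves n).addcs s hs).forget

theorem Tri.skeleton (qs : Multiset ℕ) :
    ∀ {R : ℕ} {A T cs₀ cs : Multiset ℕ} {p : ℕ}, Tri A (p ::ₘ T) cs₀ → (∀ q ∈ qs, 2 ≤ q) →
      (∀ c ∈ cs, 1 ≤ c) → excess qs = R + Multiset.card cs →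
      ∃ qs₁ qs₂ cs₁ cs₂, qs = qs₁ + qs₂ ∧ cs = cs₁ + cs₂ ∧ excess qs₂ = Multiset.card cs₂ ∧
        Multiset.card qs₁ ≤ R ∧
        Tri (A + qs₁ + Multiset.replicate (excess cs₁) 1)
          ((p + Multiset.card qs₁ + cs₁.sum) ::ₘ (Multiset.replicate R 1 + T)) (cs₀ + cs₁) := by
  induction qs using Multiset.induction_on with
  | empty =>
    intro R A T cs₀ cs p h _ _ hex
    have hR : R = 0 := by simp at hex; omega
    have hc : Multiset.card cs = 0 := by simp at hex; omega
    subst hR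
    exact ⟨0, 0, 0, cs, by simp, by simp, by simp [hc], by simp, by simpa using h⟩
  | cons q qs ih =>
    intro R A T cs₀ cs p h hq hcs hex
    have hq2 := hq q (Multiset.mem_cons_self q qs)
    rw [excess_cons] at hex
    rcases Nat.eq_zero_or_pos R with rfl | hR
    · exact ⟨0, q ::ₘ qs, 0, cs, by simp, by simp, by simpa using hex, by simp, by simpa using h⟩
    by_cases hle : q - 1 ≤ R
    · obtain ⟨qs₁, qs₂, cs₁, cs₂, h1, h2, h3, h4, h5⟩ :=
        ih (R := R - (q - 1)) (cs := cs) (h.bundle (q - 1) 0 (by simp))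
          (fun b hb => hq b (Multiset.mem_cons_of_mem hb)) hcs (by omega)
      refine ⟨q ::ₘ qs₁, qs₂, cs₁, cs₂, by simp [h1], h2, h3, ?_, ?_⟩
      · rw [Multiset.card_cons]; omega
      · convert h5 using 1
        · have : 1 + (q - 1) = q := by omega
          simp [this]
        · congr 1
          · simp only [Multiset.card_cons, Multiset.sum_zero]; omega
          · rw [← add_assoc, ← Multiset.replicate_add]
            congr 2; omega
        · simp
    · obtain ⟨s, u, rfl, hs⟩ := exists_sub_card (s := cs) (n := q - 1 - R) (by omega)
      refine ⟨{q}, qs, s, u, by simp, rfl, ?_, by simpa using Nat.succ_le_of_lt hR, ?_⟩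
      · rw [Multiset.card_add] at hex; omega
      · convert h.bundle R s (fun c hc => hcs c (Multiset.mem_add.2 (Or.inl hc))) using 1
        · have : 1 + R + Multiset.card s = q := by omega
          rw [this, add_singleton_eq_cons, Multiset.cons_add]
        · simp

theorem map_univ_eq_cons {ι : Type} [Fintype ι] [DecidableEq ι] (P : ι → ℕ) (j : ι) :
    (univ : Finset ι).val.map P = P j ::ₘ (univ.erase j).val.map P := by
  conv_lhs => rw [← Finset.insert_erase (mem_univ j),
    Finset.insert_val_of_notMem (notMem_erase _ _), Multiset.map_cons]

theorem map_univ_update {ι : Type} [Fintype ι] [DecidableEq ι] (P : ι → ℕ) (j : ι) (v : ℕ) :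
    (univ : Finset ι).val.map (Function.update P j v) = v ::ₘ (univ.erase j).val.map P := by
  rw [map_univ_eq_cons _ j, Function.update_self]
  congr 1
  apply Multiset.map_congr rfl
  intro i hi
  exact Function.update_of_ne (ne_of_mem_erase hi) _ _

theorem sum_update_add {ι : Type} [Fintype ι] [DecidableEq ι] (P : ι → ℕ) (j : ι) (b : ℕ) :
    ∑ i, Function.update P j (P j + b) i = ∑ i, P i + b := by
  change ((univ : Finset ι).val.map _).sum = ((univ : Finset ι).val.map _).sum + b
  rw [map_univ_update, map_univ_eq_cons P j]
  simp only [Multiset.sum_cons]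
  omega

theorem Tri.bundle_at {ι : Type} [Fintype ι] [DecidableEq ι] {P : ι → ℕ} {A cs : Multiset ℕ}
    (h : Tri A ((univ : Finset ι).val.map P) cs) (j : ι) (s : Multiset ℕ) (hs : ∀ c ∈ s, 1 ≤ c) :
    Tri ((1 + Multiset.card s) ::ₘ (A + Multiset.replicate (excess s) 1))
      ((univ : Finset ι).val.map (Function.update P j (P j + (1 + s.sum)))) (cs + s) := by
  rw [map_univ_eq_cons P j] at h
  rw [map_univ_update]
  simpa [add_assoc] using h.bundle 0 s hs

theorem Tri.fill {ι : Type} [Fintype ι] [DecidableEq ι] {Q : ι → ℕ} {cs : Multiset ℕ} (o : ℕ) :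
    ∀ {P : ι → ℕ} {A : Multiset ℕ}, Tri A ((univ : Finset ι).val.map P) cs → (∀ j, P j ≤ Q j) →
      ∑ j, Q j = ∑ j, P j + o →
      Tri (A + Multiset.replicate o 1) ((univ : Finset ι).val.map Q) cs := by
  induction o with
  | zero =>
    intro P A h hle hsum
    have hPQ : P = Q := by
      funext j
      exact (Finset.sum_eq_sum_iff_of_le fun i _ => hle i).1 (by simpa using hsum.symm) j
        (mem_univ j)
    simpa [hPQ] using h
  | succ o ih =>
    intro P A h hle hsum
    obtain ⟨j, -, hj⟩ : ∃ j ∈ (univ : Finset ι), P j < Q j :=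
      Finset.exists_lt_of_sum_lt (by omega)
    have hb := h.bundle_at j 0 (by simp)
    rw [add_zero] at hb
    have h' := ih hb (fun i => ?_) ?_
    · convert h' using 1
      simp [Multiset.replicate_succ]
    · by_cases hi : i = j
      · subst hi; simpa using hj
      · rw [Function.update_of_ne hi]; exact hle i
    · rw [sum_update_add, hsum]
      simp only [Multiset.sum_zero]; omega

theorem Tri.pack {ι : Type} [Fintype ι] [DecidableEq ι] {Q : ι → ℕ} {o cap : ℕ}
    (qs : Multiset ℕ) :
    ∀ {P : ι → ℕ} {A cs₀ cs : Multiset ℕ}, Tri A ((univ : Finset ι).val.map P) cs₀ →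
      (∀ j, P j ≤ Q j) → ∑ j, Q j = ∑ j, P j + Multiset.card qs + cs.sum + o →
      excess qs = Multiset.card cs → (∀ c ∈ cs, 1 ≤ c ∧ c ≤ cap) →
      (∀ q ∈ qs, 2 ≤ q ∧ (Fintype.card ι - 1) * ((q - 1) * cap) ≤ o) →
      Tri (A + qs + Multiset.replicate (excess cs) 1 + Multiset.replicate o 1)
        ((univ : Finset ι).val.map Q) (cs₀ + cs) := by
  induction qs using Multiset.induction_on with
  | empty =>
    intro P A cs₀ cs h hle hsum hex _ _
    have hcs : cs = 0 := Multiset.card_eq_zero.1 (by simpa using hex.symm)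
    subst hcs
    simpa using h.fill o hle (by simpa using hsum)
  | cons q qs ih =>
    intro P A cs₀ cs h hle hsum hex hcs hq
    obtain ⟨hq2, hqo⟩ := hq q (Multiset.mem_cons_self q qs)
    rw [excess_cons] at hex
    obtain ⟨s, u, rfl, hs⟩ := exists_sub_card (s := cs) (n := q - 1) (by omega)
    have hs1 : ∀ c ∈ s, 1 ≤ c ∧ c ≤ cap := fun c hc => hcs c (Multiset.mem_add.2 (Or.inl hc))
    have hsle : s.sum ≤ (q - 1) * cap := hs ▸ sum_le_card_mul fun c hc => (hs1 c hc).2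
    rw [Multiset.card_add] at hex
    rw [Multiset.sum_add, Multiset.card_cons] at hsum
    obtain ⟨j, hj⟩ : ∃ j, P j + (1 + s.sum) ≤ Q j := by
      by_contra! hcon
      have h1 : ∑ j, Q j ≤ ∑ j, (P j + s.sum) :=
        Finset.sum_le_sum fun j _ => by have := hcon j; omega
      rw [Finset.sum_add_distrib, Finset.sum_const, Finset.card_univ, smul_eq_mul] at h1
      have h2 : (Fintype.card ι - 1) * s.sum ≤ (Fintype.card ι - 1) * ((q - 1) * cap) :=
        Nat.mul_le_mul_left _ hsle
      rcases Nat.eq_zero_or_pos (Fintype.card ι) with h0 | h0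
      · rw [h0] at h1; omega
      · obtain ⟨n, hn⟩ : ∃ n, Fintype.card ι = n + 1 := ⟨Fintype.card ι - 1, by omega⟩
        rw [hn] at h1 h2 hqo
        rw [add_mul, one_mul] at h1
        simp only [Nat.add_sub_cancel] at h2 hqo
        omega
    have h' := ih (h.bundle_at j s fun c hc => (hs1 c hc).1) (cs := u) (fun i => ?_) ?_ (by omega)
      (fun c hc => hcs c (Multiset.mem_add.2 (Or.inr hc)))
      (fun b hb => hq b (Multiset.mem_cons_of_mem hb))
    · convert h' using 1
      · have : 1 + Multiset.card s = q := by omega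
        rw [this, excess_add, Multiset.replicate_add]
        simp only [← Multiset.singleton_add]
        abel
      · rw [add_assoc]
    · by_cases hi : i = j
      · subst hi; simpa using hj
      · rw [Function.update_of_ne hi]; exact hle i
    · rw [sum_update_add]; omega

theorem exists_fin_fun (T : Multiset ℕ) :
    ∃ g : Fin (Multiset.card T) → ℕ, (univ : Finset (Fin (Multiset.card T))).val.map g = T := by
  refine ⟨fun i => T.toList.get (i.cast (by simp)), ?_⟩
  rw [Fin.univ_val_map]
  conv_rhs => rw [← Multiset.coe_toList T]
  congr 1
  apply List.ext_get
  · simp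
  · simp

theorem Tri.exists_of_le {qs cs T : Multiset ℕ} {f cap : ℕ} (hq : ∀ q ∈ qs, 2 ≤ q)
    (hT : ∀ a ∈ T, 1 ≤ a) (hT0 : 2 ≤ Multiset.card T) (hsum : qs.sum + f = T.sum)
    (hex : excess qs = Multiset.card T - 1 + Multiset.card cs)
    (hcs : ∀ c ∈ cs, 1 ≤ c ∧ c ≤ cap)
    (hf : 1 + excess cs ≤ f)
    (ho : ∀ q ∈ qs, q - 1 ≤ Multiset.card cs →
      (Multiset.card T - 1) * ((q - 1) * cap) + 1 + excess cs ≤ f)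
    (hroot : Multiset.card T * (Multiset.card T + cs.sum) ≤ T.sum + Multiset.card T - 1) :
    Tri (qs + Multiset.replicate f 1) T cs := by
  obtain ⟨pm, hpm, hpm'⟩ : ∃ p ∈ T, Multiset.card T + cs.sum ≤ p := by
    by_contra! hcon
    have := sum_le_card_mul (s := T) (c := Multiset.card T + cs.sum - 1) fun a ha => by
      have := hcon a ha; omega
    have h2 : Multiset.card T * (Multiset.card T + cs.sum - 1) + Multiset.card T =
        Multiset.card T * (Multiset.card T + cs.sum) := by
      have h3 : Multiset.card T + cs.sum = (Multiset.card T + cs.sum - 1) + 1 := by omega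
      conv_rhs => rw [h3, Nat.mul_add_one]
    omega
  obtain ⟨T', rfl⟩ := Multiset.exists_cons_of_mem hpm
  simp only [Multiset.card_cons, Nat.add_sub_cancel] at *
  obtain ⟨qs₁, qs₂, cs₁, cs₂, rfl, rfl, h3, h4, h5⟩ :=
    Tri.skeleton qs (R := Multiset.card T') (cs := cs) (T := 0) (by simpa using Tri.base) hq
      (fun c hc => (hcs c hc).1) hex
  obtain ⟨o, ho'⟩ : ∃ o, f = 1 + excess (cs₁ + cs₂) + o := ⟨f - (1 + excess (cs₁ + cs₂)), by omega⟩
  obtain ⟨g, hg⟩ := exists_fin_fun T'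
  have hgs : ∑ i, g i = T'.sum := congrArg Multiset.sum hg
  have hcons : ∀ (x : ℕ) (g : Fin (Multiset.card T') → ℕ),
      (univ : Finset (Fin (Multiset.card T' + 1))).val.map (Fin.cons x g : Fin _ → ℕ) =
        x ::ₘ (univ : Finset (Fin (Multiset.card T'))).val.map g := by
    intro x g
    rw [Fin.univ_val_map, Fin.univ_val_map, List.ofFn_succ]
    simp
  have hP : (1 + Multiset.card qs₁ + cs₁.sum) ::ₘ (Multiset.replicate (Multiset.card T') 1 + 0) =
      (univ : Finset (Fin (Multiset.card T' + 1))).val.map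
        (Fin.cons (1 + Multiset.card qs₁ + cs₁.sum) (fun _ => 1) : Fin _ → ℕ) := by
    rw [hcons]
    simp
  rw [hP] at h5
  have hqs1 := excess_add_card (s := qs₁ + qs₂) fun q h => le_trans (by norm_num) (hq q h)
  have hcs1 := excess_add_card (s := cs₁ + cs₂) fun c h => (hcs c h).1
  have h6 := h5.pack qs₂ (Q := Fin.cons pm g) (o := o) (cap := cap) (cs := cs₂) ?_ ?_ h3
    (fun c hc => hcs c (Multiset.mem_add.2 (Or.inr hc))) ?_
  · convert h6 using 1
    · rw [ho', excess_add, Multiset.replicate_add, Multiset.replicate_add, Multiset.replicate_add]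
      simp only [Multiset.replicate_one]
      abel
    · rw [hcons, hg]
    · simp
  · intro j
    refine Fin.cases ?_ (fun j => ?_) j
    · simp only [Fin.cons_zero]
      rw [Multiset.sum_add] at hpm'
      omega
    · simp only [Fin.cons_succ]
      apply hT
      apply Multiset.mem_cons_of_mem
      rw [← hg, Multiset.mem_map]
      exact ⟨j, by simp, rfl⟩
  · rw [Fin.sum_univ_succ, Fin.sum_univ_succ]
    simp only [Fin.cons_zero, Fin.cons_succ, hgs, Finset.sum_const, Finset.card_univ,
      Fintype.card_fin, smul_eq_mul, mul_one]
    simp only [Multiset.sum_add, Multiset.card_add, Multiset.sum_cons] at *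
    omega
  · intro q hq'
    refine ⟨hq q (Multiset.mem_add.2 (Or.inr hq')), ?_⟩
    have := ho q (Multiset.mem_add.2 (Or.inr hq')) (by
      obtain ⟨R, rfl⟩ := Multiset.exists_cons_of_mem hq'
      rw [excess_cons] at h3
      rw [Multiset.card_add]
      omega)
    rw [Fintype.card_fin, Nat.add_sub_cancel]
    omega

/-- The subset of the space defined by `p` is stable under all members of `l`. -/
def Stable {X : Type} (l : List (Perm X)) (p : X → Prop) : Prop := ∀ σ ∈ l, ∀ x, p (σ x) ↔ p x

/-- The permutations in `l` generate a transitive group. -/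
def Conn {X : Type} (l : List (Perm X)) : Prop := ∀ p, Stable l p → ∀ x y, p x → p y

theorem iff_inv {X : Type} {σ : Perm X} {p : X → Prop} (h : ∀ x, p (σ x) ↔ p x) (x : X) :
    p (σ⁻¹ x) ↔ p x := by
  rw [← h (σ⁻¹ x)]
  simp

theorem iff_of_sameCycle {X : Type} {σ : Perm X} {p : X → Prop} (h : ∀ x, p (σ x) ↔ p x)
    {x y : X} (hxy : σ.SameCycle x y) : p x ↔ p y :=
  sameCycle_le (E := fun x y => (p x ↔ p y)) ⟨fun _ => Iff.rfl, Iff.symm, Iff.trans⟩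
    (fun x => (h x).symm) hxy

theorem Stable.prod {X : Type} {l : List (Perm X)} {p : X → Prop} (h : Stable l p) (x : X) :
    p (l.prod x) ↔ p x := by
  induction l with
  | nil => simp
  | cons σ l ih =>
    rw [List.prod_cons, Perm.mul_apply, h σ (by simp)]
    exact ih fun τ hτ => h τ (List.mem_cons_of_mem _ hτ)

theorem conn_of_prod {X : Type} {l : List (Perm X)} (h : ∀ x y, l.prod.SameCycle x y) :
    Conn l :=
  fun _ hp x y hx => (iff_of_sameCycle hp.prod (h x y)).1 hx

/-- There is a tuple of permutations of types `L` with product of type `T`. -/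
def Fac (L : List (Multiset ℕ)) (T : Multiset ℕ) : Prop :=
  ∃ (X : Type) (_ : Fintype X) (l : List (Perm X)), l.map ctype = L ∧ ctype l.prod = T

/-- There is a transitive tuple of permutations of types `L` with product of type `T`. -/
def TransFac (L : List (Multiset ℕ)) (T : Multiset ℕ) : Prop :=
  ∃ (X : Type) (_ : Fintype X) (l : List (Perm X)), l.map ctype = L ∧ ctype l.prod = T ∧ Conn l

theorem exists_list_reorder {X : Type} [Fintype X] {L L' : List (Multiset ℕ)} (h : L.Perm L') :
    ∀ l : List (Perm X), l.map ctype = L →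
      ∃ l' : List (Perm X), l'.map ctype = L' ∧ l'.prod = l.prod ∧
        ∀ p, Stable l' p → Stable l p := by
  induction h with
  | nil => intro l hl; exact ⟨l, hl, rfl, fun _ h => h⟩
  | cons P _ ih =>
    intro l hl
    obtain ⟨σ, l, rfl⟩ := List.exists_cons_of_ne_nil (l := l) (by rintro rfl; simp at hl)
    rw [List.map_cons, List.cons.injEq] at hl
    obtain ⟨l', h1, h2, h3⟩ := ih l hl.2
    refine ⟨σ :: l', by simp [h1, hl.1], by simp [h2], fun p hp => ?_⟩
    intro τ hτ
    rcases List.mem_cons.1 hτ with rfl | hτ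
    · exact hp _ (by simp)
    · exact h3 p (fun ρ hρ => hp ρ (List.mem_cons_of_mem _ hρ)) τ hτ
  | swap P Q L =>
    intro l hl
    obtain ⟨σ, l, rfl⟩ := List.exists_cons_of_ne_nil (l := l) (by rintro rfl; simp at hl)
    rw [List.map_cons, List.cons.injEq] at hl
    obtain ⟨τ, l, rfl⟩ := List.exists_cons_of_ne_nil (l := l) (by rintro rfl; simp at hl)
    rw [List.map_cons, List.cons.injEq] at hl
    refine ⟨σ * τ * σ⁻¹ :: σ :: l, by simp [ctype_conj, hl.1, hl.2.1, hl.2.2],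
      by simp [mul_assoc], fun p hp ρ hρ => ?_⟩
    have hσ := hp σ (by simp)
    rcases List.mem_cons.1 hρ with rfl | hρ
    · exact hσ
    rcases List.mem_cons.1 hρ with rfl | hρ
    · intro x
      have h1 := hp _ (List.mem_cons_self (a := σ * ρ * σ⁻¹)) (σ x)
      rw [← hσ (ρ x), ← hσ x, ← h1]
      simp
    · exact hp ρ (by simp [hρ])
  | trans _ _ ih1 ih2 =>
    intro l hl
    obtain ⟨l1, h1, h2, h3⟩ := ih1 l hl
    obtain ⟨l2, h4, h5, h6⟩ := ih2 l1 h1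
    exact ⟨l2, h4, h5.trans h2, fun p hp => h3 p (h6 p hp)⟩

theorem TransFac.perm {L L' : List (Multiset ℕ)} {T : Multiset ℕ} (h : TransFac L T) (hL : L.Perm L') :
    TransFac L' T := by
  obtain ⟨X, _, l, h1, h2, h3⟩ := h
  obtain ⟨l', h4, h5, h6⟩ := exists_list_reorder hL l h1
  exact ⟨X, _, l', h4, by rw [h5, h2], fun p hp => h3 p (h6 p hp)⟩

theorem Fac.perm {L L' : List (Multiset ℕ)} {T : Multiset ℕ} (h : Fac L T) (hL : L.Perm L') :
    Fac L' T := by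
  obtain ⟨X, _, l, h1, h2⟩ := h
  obtain ⟨l', h4, h5, h6⟩ := exists_list_reorder hL l h1
  exact ⟨X, _, l', h4, by rw [h5, h2]⟩

theorem exists_list_prod_eq {X Y : Type} [Fintype X] [Fintype Y] {l : List (Perm Y)} {q : Perm X}
    (h : ctype l.prod = ctype q) :
    ∃ l' : List (Perm X), l'.map ctype = l.map ctype ∧ l'.prod = q ∧ (Conn l → Conn l') := by
  obtain ⟨e, he⟩ := exists_conj h
  refine ⟨l.map e.permCongrHom, ?_, ?_, fun hc p hp x y hx => ?_⟩
  · rw [List.map_map]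
    apply List.map_congr_left
    intro σ _
    exact (ctype_congr e (by simp)).symm
  · rw [← map_list_prod]
    ext x
    obtain ⟨x, rfl⟩ := e.surjective x
    simp [he]
  · have h1 := hc (fun z => p (e z)) (fun σ hσ z => ?_) (e.symm x) (e.symm y) (by simpa using hx)
    · simpa using h1
    · have := hp (e.permCongrHom σ) (List.mem_map_of_mem hσ) (e z)
      simpa using this

theorem exists_perm_ctype (R : Multiset ℕ) (h : ∀ a ∈ R, 1 ≤ a) :
    ∃ (X : Type) (_ : Fintype X) (ρ : Perm X), ctype ρ = R := by
  induction R using Multiset.induction_on with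
  | empty => exact ⟨Empty, inferInstance, 1, by simp [ctype_one]⟩
  | cons a R ih =>
    obtain ⟨X, _, ρ, hρ⟩ := ih fun b hb => h b (Multiset.mem_cons_of_mem hb)
    obtain ⟨τ, -, hτ⟩ := exists_cycle (h a (Multiset.mem_cons_self a R))
    exact ⟨Fin a ⊕ X, inferInstance, Perm.sumCongr τ ρ, by
      rw [ctype_sumCongr, hτ, hρ, Multiset.singleton_add]⟩

theorem prod_map_sumCongr {X Y : Type} (l : List (Perm X)) :
    (l.map fun σ => (Perm.sumCongr σ 1 : Perm (X ⊕ Y))).prod = Perm.sumCongr l.prod 1 := by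
  induction l with
  | nil => simp
  | cons σ l ih => rw [List.map_cons, List.prod_cons, List.prod_cons, ih, Perm.sumCongr_mul, one_mul]

/-- Products of permutations realizing a long cycle in genus zero. -/
theorem transFac_singleton {d : ℕ} (hd : 1 ≤ d) : ∀ (L : List (Multiset ℕ)),
    (∀ P ∈ L, P.sum = d ∧ ∀ a ∈ P, 1 ≤ a) → (L.map excess).sum + 1 = d → TransFac L {d} := by
  classical
  induction d, hd using Nat.le_induction with
  | base =>
    intro L hL _
    refine ⟨Unit, inferInstance, L.map fun _ => 1, ?_, ?_, ?_⟩
    · rw [List.map_map]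
      conv_rhs => rw [← List.map_id L]
      apply List.map_congr_left
      intro P hP
      obtain ⟨h1, h2⟩ := hL P hP
      have h3 := excess_add_card h2
      have h4 : Multiset.card P = 1 := by
        have : P ≠ 0 := by rintro rfl; simp at h1
        have := Multiset.card_pos.2 this
        omega
      obtain ⟨a, rfl⟩ := Multiset.card_eq_one.1 h4
      simp only [Multiset.sum_singleton] at h1
      simp [ctype_one, h1]
    · have h : ∀ σ : Perm Unit, σ = 1 := fun σ => Subsingleton.elim _ _
      rw [h (List.prod _), ctype_one]
      simp
    · intro p _ x y h; exact h
  | succ d hd ih =>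
    intro L hL hsum
    obtain ⟨P, hPL, hP1, hP⟩ : ∃ P ∈ L, 1 ≤ excess P ∧ ∀ P' ∈ L.erase P, 1 ∈ P' := by
      have hno : ∀ P ∈ L, 1 ∉ P → d + 1 ≤ 2 * excess P := by
        intro P hP h1
        obtain ⟨h2, h3⟩ := hL P hP
        have h4 := excess_add_card h3
        have h5 := card_mul_le_sum (s := P) (c := 2) fun a ha => by
          have := h3 a ha
          have : a ≠ 1 := fun h => h1 (h ▸ ha)
          omega
        omega
      have hperm : ∀ P ∈ L, (L.map excess).sum = excess P + ((L.erase P).map excess).sum := by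
        intro P hP
        have := ((List.perm_cons_erase hP).map excess).sum_eq
        simpa using this
      by_cases hex : ∃ P ∈ L, 1 ∉ P
      · obtain ⟨P, hP, h1⟩ := hex
        have h2 := hno P hP h1
        refine ⟨P, hP, by omega, fun P' hP' => ?_⟩
        by_contra h3
        have h4 := hno P' (List.mem_of_mem_erase hP') h3
        have h5 := hperm P hP
        have h6 : excess P' ≤ ((L.erase P).map excess).sum :=
          List.le_sum_of_mem (List.mem_map_of_mem hP')
        omega
      · push Not at hex
        obtain ⟨P, hP, h1⟩ : ∃ P ∈ L, 1 ≤ excess P := by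
          by_contra! hcon
          have : (L.map excess).sum = 0 := by
            rw [List.sum_eq_zero_iff_forall_eq_nat]
            intro a ha
            obtain ⟨P, hP, rfl⟩ := List.mem_map.1 ha
            have := hcon P hP
            omega
          omega
        exact ⟨P, hP, h1, fun P' hP' => hex P' (List.mem_of_mem_erase hP')⟩
    refine TransFac.perm ?_ (List.perm_cons_erase hPL).symm
    have hsum' : (L.map excess).sum = excess P + ((L.erase P).map excess).sum := by
      have := ((List.perm_cons_erase hPL).map excess).sum_eq
      simpa using this
    have hL' : ∀ P' ∈ L.erase P, P'.sum = d + 1 ∧ ∀ a ∈ P', 1 ≤ a :=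
      fun P' hP' => hL P' (List.mem_of_mem_erase hP')
    obtain ⟨hPs, hPp⟩ := hL P hPL
    generalize L.erase P = L₁ at *
    obtain ⟨q, hqP, hq⟩ : ∃ q ∈ P, 2 ≤ q := by
      by_contra! hcon
      have : excess P = 0 := by
        unfold excess
        rw [Multiset.sum_eq_zero_iff]
        intro a ha
        obtain ⟨b, hb, rfl⟩ := Multiset.mem_map.1 ha
        have := hcon b hb
        omega
      omega
    obtain ⟨R, rfl⟩ := Multiset.exists_cons_of_mem hqP
    have hih : TransFac (((q - 1) ::ₘ R) :: L₁.map fun P' => P'.erase 1) {d} := by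
      refine ih _ ?_ ?_
      · intro P' hP'
        rcases List.mem_cons.1 hP' with rfl | hP'
        · refine ⟨by simp only [Multiset.sum_cons] at *; omega, fun a ha => ?_⟩
          rcases Multiset.mem_cons.1 ha with rfl | ha
          · omega
          · exact hPp a (Multiset.mem_cons_of_mem ha)
        · obtain ⟨P'', hP'', rfl⟩ := List.mem_map.1 hP'
          obtain ⟨h1, h2⟩ := hL' P'' hP''
          have h3 := Multiset.cons_erase (hP P'' hP'')
          rw [← h3, Multiset.sum_cons] at h1
          exact ⟨by omega, fun a ha => h2 a (Multiset.mem_of_mem_erase ha)⟩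
      · have h3 : (L₁.map fun P' => P'.erase 1).map excess = L₁.map excess := by
          rw [List.map_map]
          apply List.map_congr_left
          intro P' hP'
          conv_rhs => rw [← Multiset.cons_erase (hP P' hP')]
          simp
        rw [List.map_cons, List.sum_cons, h3]
        simp only [excess_cons] at *
        omega
    obtain ⟨X, _, l, h1, h2, -⟩ := hih
    obtain ⟨b, l, rfl⟩ := List.exists_cons_of_ne_nil (l := l) (by rintro rfl; simp at h1)
    rw [List.map_cons, List.cons.injEq] at h1
    obtain ⟨hb, hl⟩ := h1
    obtain ⟨y, hy⟩ := exists_cyc_eq b (c := q - 1) (by rw [hb]; simp)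
    have hcard : Fintype.card X = d := by rw [← ctype_sum, h2]; simp
    have hcyc : cyc (b :: l).prod y = d := by
      rw [cyc_eq_card (ctype_eq_singleton_iff h2), hcard]
    let l' : List (Perm (X ⊕ Unit)) := swap (Sum.inl y) (Sum.inr ()) * Perm.sumCongr b 1 ::
      l.map fun σ => Perm.sumCongr σ 1
    have hprod : ctype l'.prod = {d + 1} := by
      rw [List.prod_cons, prod_map_sumCongr, mul_assoc, Perm.sumCongr_mul, one_mul,
        ← List.prod_cons, ctype_swap_mul_eq (R := 0) (by simp)]
      · rw [cyc_sumCongr_inl, hcyc]; simp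
      · rw [cyc_sumCongr_inl, hcyc, ctype_sumCongr, h2, ctype_one]; simp
    refine ⟨X ⊕ Unit, inferInstance, l', ?_, hprod, conn_of_prod (ctype_eq_singleton_iff hprod)⟩
    rw [List.map_cons, ctype_swap_mul_eq (R := R) (by simp)]
    · congr 1
      · rw [cyc_sumCongr_inl, hy, cyc_sumCongr_inr, cyc_one]
        congr 1; omega
      · rw [List.map_map]
        have : (ctype ∘ fun σ : Perm X => (Perm.sumCongr σ 1 : Perm (X ⊕ Unit))) =
            (fun s => 1 ::ₘ s) ∘ ctype := by
          funext σ
          simp [ctype_sumCongr, ctype_one, add_singleton_eq_cons]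
        rw [this, ← List.map_map, hl, List.map_map]
        conv_rhs => rw [← List.map_id L₁]
        apply List.map_congr_left
        intro P' hP'
        exact Multiset.cons_erase (hP P' hP')
    · rw [cyc_sumCongr_inl, hy, ctype_sumCongr, hb, ctype_one]
      simp [add_singleton_eq_cons, Multiset.cons_swap]

theorem Tri.compose {A T cs : Multiset ℕ} {C : ℕ} {L : List (Multiset ℕ)} (h : Tri A T cs)
    (hL : Fac L (C ::ₘ cs)) (hC : C + cs.sum = A.sum) : TransFac (A :: L) T := by
  obtain ⟨X, _, a, q, z, h1, h2, h3, h4⟩ := h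
  obtain ⟨Y, _, l, h5, h6⟩ := hL
  have h7 := ctype_sum a
  have h8 := ctype_sum q
  rw [h1] at h7
  rw [h3, Multiset.sum_cons] at h8
  have h9 : cyc q z = C := by omega
  rw [h9, ← h6] at h3
  obtain ⟨l', h10, h11, -⟩ := exists_list_prod_eq h3.symm
  refine ⟨X, inferInstance, a :: l', by simp [h1, h10, h5], by simp [h11, h2], fun p hp => ?_⟩
  have ha : ∀ x, p (a x) ↔ p x := hp a (by simp)
  have hq : ∀ x, p (q x) ↔ p x := fun x => by
    rw [← h11]
    exact Stable.prod (fun σ hσ => hp σ (List.mem_cons_of_mem _ hσ)) x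
  have key : ∀ x, p x ↔ p z := by
    intro x
    obtain ⟨y, hy1, hy2⟩ := h4 x
    exact (iff_of_sameCycle (σ := a * q) (fun x => by rw [Perm.mul_apply, ha, hq]) hy1).trans
      (iff_of_sameCycle hq hy2).symm
  exact fun x y hx => (key y).2 ((key x).1 hx)

theorem TransFac.attach {B U R : Multiset ℕ} {N : ℕ} {L : List (Multiset ℕ)} (hN : 1 ≤ N)
    (hB : B.sum = N ∧ ∀ a ∈ B, 1 ≤ a) (hU : U.sum = N ∧ ∀ a ∈ U, 1 ≤ a)
    (hBU : excess B + excess U + 1 = N) (h : TransFac L (N ::ₘ R)) :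
    TransFac ((B + Multiset.replicate R.sum 1) :: L) (U + R) := by
  obtain ⟨X, _, l, h1, h2, h3⟩ := h
  have hR : ∀ a ∈ R, 1 ≤ a := fun a ha =>
    ctype_pos l.prod a (by rw [h2]; exact Multiset.mem_cons_of_mem ha)
  obtain ⟨Z, _, ρ, hρ⟩ := exists_perm_ctype R hR
  obtain ⟨Y, _, l₂, h4, h5, -⟩ := transFac_singleton hN [B, U] (by simpa using ⟨hB, hU⟩)
    (by simpa using hBU)
  obtain ⟨b, l₂, rfl⟩ := List.exists_cons_of_ne_nil (l := l₂) (by rintro rfl; simp at h4)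
  rw [List.map_cons, List.cons.injEq] at h4
  obtain ⟨u, l₂, rfl⟩ := List.exists_cons_of_ne_nil (l := l₂) (by rintro rfl; simp at h4)
  rw [List.map_cons, List.cons.injEq, List.map_eq_nil_iff] at h4
  obtain ⟨hb, hu, rfl⟩ := h4
  simp only [List.prod_cons, List.prod_nil, mul_one] at h5
  obtain ⟨l', h6, h7, h8⟩ := exists_list_prod_eq (l := l)
    (q := (Perm.sumCongr (b * u) ρ : Perm (Y ⊕ Z))) (by
      rw [h2, ctype_sumCongr, h5, hρ, Multiset.singleton_add])
  refine ⟨Y ⊕ Z, inferInstance, Perm.sumCongr b⁻¹ 1 :: l', ?_, ?_, ?_⟩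
  · rw [List.map_cons, h6, h1, ctype_sumCongr, ctype_inv, hb, ctype_one, ← ctype_sum ρ, hρ]
  · rw [List.prod_cons, h7, sumCongr_mul_one, inv_mul_cancel_left, ctype_sumCongr, hu, hρ]
  · exact fun p hp => h8 h3 p fun σ hσ => hp σ (List.mem_cons_of_mem _ hσ)

theorem exists_split_ones {P : Multiset ℕ} (h : ∀ a ∈ P, 1 ≤ a) :
    ∃ qs f, P = qs + Multiset.replicate f 1 ∧ ∀ q ∈ qs, 2 ≤ q := by
  refine ⟨P.filter (2 ≤ ·), Multiset.card (P.filter (¬ 2 ≤ ·)), ?_,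
    fun q hq => (Multiset.mem_filter.1 hq).2⟩
  conv_lhs => rw [← Multiset.filter_add_not (2 ≤ ·) P]
  congr 1
  refine Multiset.eq_replicate_card.2 fun a ha => ?_
  obtain ⟨h1, h2⟩ := Multiset.mem_filter.1 ha
  have := h a h1
  omega

theorem card_le_excess {s : Multiset ℕ} (h : ∀ q ∈ s, 2 ≤ q) : Multiset.card s ≤ excess s := by
  have h1 := excess_add_card (s := s) fun q hq => le_trans (by norm_num) (h q hq)
  have h2 := card_mul_le_sum h
  omega

theorem excess_le {s : Multiset ℕ} {E : ℕ} (hs : ∀ a ∈ s, 1 ≤ a) (h : E + 2 * excess s ≤ s.sum) :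
    ∃ s', s = s' + Multiset.replicate E 1 := by
  obtain ⟨qs, f, rfl, hq⟩ := exists_split_ones hs
  have h1 := excess_add_card (s := qs) fun q hq' => le_trans (by norm_num) (hq q hq')
  have h2 := card_le_excess hq
  simp only [excess_add, excess_replicate_one, Multiset.sum_add, Multiset.sum_replicate,
    smul_eq_mul, mul_one] at h
  obtain ⟨g, rfl⟩ : ∃ g, f = g + E := ⟨f - E, by omega⟩
  exact ⟨qs + Multiset.replicate g 1, by rw [add_assoc, ← Multiset.replicate_add]⟩

theorem exists_smallest {s : Multiset ℕ} (h : ∀ a ∈ s, 1 ≤ a) (n : ℕ)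
    (hn : n ≤ Multiset.card s) :
    ∃ t u c, s = t + u ∧ Multiset.card t = n ∧ 1 ≤ c ∧ (∀ a ∈ t, a ≤ c) ∧ ∀ a ∈ u, c ≤ a := by
  induction n with
  | zero => exact ⟨0, s, 1, by simp, rfl, le_rfl, by simp, h⟩
  | succ n ih =>
    obtain ⟨t, u, c, rfl, h1, h2, h3, h4⟩ := ih (by omega)
    rw [Multiset.card_add] at hn
    have hu : u.toFinset.Nonempty := by
      rw [Multiset.toFinset_nonempty]
      rintro rfl
      simp at hn
      omega
    obtain ⟨m, hm, hmin⟩ := u.toFinset.exists_min_image id hu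
    rw [Multiset.mem_toFinset] at hm
    obtain ⟨u, rfl⟩ := Multiset.exists_cons_of_mem hm
    refine ⟨m ::ₘ t, u, m, by simp, by simp [h1], h2.trans (h4 m hm), fun a ha => ?_,
      fun a ha => hmin a (by simp [ha])⟩
    rcases Multiset.mem_cons.1 ha with rfl | ha
    · exact le_rfl
    · exact (h3 a ha).trans (h4 m hm)

theorem TransFac.fac_glue {u cs : Multiset ℕ} {C : ℕ} {O : List (Multiset ℕ)}
    (h : TransFac (u :: O) {C}) (hcs : ∀ c ∈ cs, 1 ≤ c) :
    Fac ((u + cs) :: O.map (· + Multiset.replicate cs.sum 1)) (C ::ₘ cs) := by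
  obtain ⟨X, _, l, h1, h2, -⟩ := h
  obtain ⟨Z, _, ρ, hρ⟩ := exists_perm_ctype cs hcs
  obtain ⟨b, l, rfl⟩ := List.exists_cons_of_ne_nil (l := l) (by rintro rfl; simp at h1)
  rw [List.map_cons, List.cons.injEq] at h1
  obtain ⟨hb, hl⟩ := h1
  refine ⟨X ⊕ Z, inferInstance, Perm.sumCongr b ρ :: l.map fun σ => Perm.sumCongr σ 1, ?_, ?_⟩
  · rw [List.map_cons, ctype_sumCongr, hb, hρ, ← hl, List.map_map, List.map_map]
    congr 1
    apply List.map_congr_left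
    intro σ _
    simp [ctype_sumCongr, ctype_one, ← ctype_sum ρ, hρ]
  · rw [List.prod_cons, prod_map_sumCongr, Perm.sumCongr_mul, mul_one, ← List.prod_cons,
      ctype_sumCongr, h2, hρ, Multiset.singleton_add]

theorem exists_map_add_eq {O : List (Multiset ℕ)} {e : Multiset ℕ}
    (h : ∀ Q ∈ O, ∃ Q', Q = Q' + e) : ∃ O' : List (Multiset ℕ), O = O'.map (· + e) := by
  induction O with
  | nil => exact ⟨[], rfl⟩
  | cons Q O ih =>
    obtain ⟨Q', hQ'⟩ := h Q (by simp)
    obtain ⟨O', hO'⟩ := ih fun Q hQ => h Q (by simp [hQ])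
    exact ⟨Q' :: O', by simp [hQ', hO']⟩

theorem transFac_of_le_excess {d ρ t : ℕ} {P Pm T : Multiset ℕ} {O : List (Multiset ℕ)}
    (hρ : 1 ≤ ρ) (ht : 1 ≤ t) (hT : T.sum = d ∧ ∀ a ∈ T, 1 ≤ a) (hTc : Multiset.card T = ρ + 1)
    (hP : P.sum = d ∧ ∀ a ∈ P, 1 ≤ a) (hv : excess P = ρ + t)
    (hPm : Pm.sum = d ∧ ∀ a ∈ Pm, 1 ≤ a) (hvm : ρ + t ≤ excess Pm)
    (hO : ∀ Q ∈ O, (Q.sum = d ∧ ∀ a ∈ Q, 1 ≤ a) ∧ ρ + t ≤ excess Q ∧ excess Q ≤ excess Pm)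
    (hOl : ρ ≤ O.length)
    (hsum : d = t + 1 + excess Pm + (O.map excess).sum) : TransFac (P :: Pm :: O) T := by
  have hW : ρ * (ρ + t) ≤ (O.map excess).sum := by
    refine (Nat.mul_le_mul_right _ hOl).trans ?_
    have := List.card_nsmul_le_sum (O.map excess) (ρ + t) (by
      intro x hx
      obtain ⟨Q, hQ, rfl⟩ := List.mem_map.1 hx
      exact (hO Q hQ).2.1)
    simpa using this
  have hWQ : ∀ Q ∈ O, excess Q ≤ (O.map excess).sum := fun Q hQ =>
    List.le_sum_of_mem (List.mem_map_of_mem hQ)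
  generalize hWd : (O.map excess).sum = W at *
  obtain ⟨qs, f, rfl, hq⟩ := exists_split_ones hP.2
  have hPmc := excess_add_card hPm.2
  obtain ⟨cs, u, c, rfl, hcs, hc, hcsc, huc⟩ := exists_smallest hPm.2 t (by omega)
  have hcs1 : ∀ a ∈ cs, 1 ≤ a := fun a ha => hPm.2 a (by simp [ha])
  have hu1 : ∀ a ∈ u, 1 ≤ a := fun a ha => hPm.2 a (by simp [ha])
  have e1 := excess_add_card hcs1
  have e2 := excess_add_card hu1
  have e3 := card_mul_le_sum huc
  have e4 := sum_le_card_mul hcsc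
  have e5 := excess_add_card (s := qs) fun q hq' => le_trans (by norm_num) (hq q hq')
  have e6 := card_le_excess hq
  obtain ⟨hPm', -⟩ := hPm
  obtain ⟨hP', -⟩ := hP
  simp only [excess_add, Multiset.sum_add, Multiset.card_add, excess_replicate_one,
    Multiset.sum_replicate, smul_eq_mul, mul_one, add_zero] at *
  have hcu : Multiset.card u = W + 1 := by omega
  rw [hcu] at e2 e3
  rw [hcs] at e1 e4
  generalize hE : cs.sum = E at *
  have hdE : E + (W + 1) * c ≤ d := by omega
  have hcase : c = 1 ∧ E = t ∨ 2 ≤ c := by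
    rcases Nat.lt_or_ge c 2 with h | h
    · left
      have : c = 1 := by omega
      subst this
      omega
    · exact Or.inr h
  have hones : ∀ Q ∈ O, ∃ Q', Q = Q' + Multiset.replicate E 1 := by
    intro Q hQ
    obtain ⟨⟨h1, h2⟩, h3, h4⟩ := hO Q hQ
    have h5 := hWQ Q hQ
    refine excess_le h2 ?_
    rcases hcase with ⟨rfl, rfl⟩ | hc2
    · omega
    · have : (W + 1) * 2 ≤ (W + 1) * c := Nat.mul_le_mul_left _ hc2
      omega
  obtain ⟨O', rfl⟩ := exists_map_add_eq hones
  have hO' : O'.map excess = (O'.map (· + Multiset.replicate E 1)).map excess := by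
    rw [List.map_map]
    exact List.map_congr_left fun Q _ => by simp
  have hfac := (transFac_singleton (d := u.sum) (by omega) (u :: O') (by
      intro Q hQ
      rcases List.mem_cons.1 hQ with rfl | hQ
      · exact ⟨rfl, hu1⟩
      · have h1 := (hO _ (List.mem_map_of_mem hQ)).1
        simp only [Multiset.sum_add, Multiset.sum_replicate, smul_eq_mul, mul_one] at h1
        exact ⟨by omega, fun a ha => h1.2 a (by simp [ha])⟩)
    (by rw [List.map_cons, List.sum_cons, hO', hWd]; omega)).fac_glue hcs1
  rw [hE, add_comm u] at hfac
  refine Tri.compose (Tri.exists_of_le (cap := c) hq hT.2 (by omega) (by omega) (by omega)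
    (fun a ha => ⟨hcs1 a ha, hcsc a ha⟩) ?_ ?_ ?_) hfac (by
      simp only [Multiset.sum_add, Multiset.sum_replicate, smul_eq_mul, mul_one]; omega)
  · rcases hcase with ⟨rfl, rfl⟩ | hc2
    · have : 1 * (ρ + E) ≤ ρ * (ρ + E) := Nat.mul_le_mul_right _ hρ
      omega
    · have h1 : (W + 1) * 2 ≤ (W + 1) * c := Nat.mul_le_mul_left _ hc2
      have h2 : 1 * (ρ + t) ≤ ρ * (ρ + t) := Nat.mul_le_mul_right _ hρ
      omega
  · intro q hqq hqt
    obtain ⟨R, rfl⟩ := Multiset.exists_cons_of_mem hqq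
    have hR := card_le_excess fun q hq' => hq q (Multiset.mem_cons_of_mem hq')
    have hq2 := hq q hqq
    obtain ⟨x, rfl⟩ : ∃ x, q = x + 1 := ⟨q - 1, by omega⟩
    rw [excess_cons] at hv
    rw [hcs] at hqt
    simp only [Multiset.card_cons, excess_cons] at e5 e6
    rw [hTc]
    simp only [Nat.add_sub_cancel] at *
    obtain ⟨z, rfl⟩ : ∃ z, t = x + z := ⟨t - x, by omega⟩
    suffices key : ρ * (x * c) + 1 + E + ρ + 1 + (ρ + z) ≤ d by omega
    rcases hcase with ⟨rfl, rfl⟩ | hc2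
    · have h1 : 1 * (ρ + z) ≤ ρ * (ρ + z) := Nat.mul_le_mul_right _ hρ
      have h2 : ρ * (ρ + (x + z)) = ρ * (x * 1) + ρ * (ρ + z) := by ring
      omega
    · have h1 : (ρ * (ρ + (x + z)) + 1) * c ≤ (W + 1) * c := Nat.mul_le_mul_right _ (by omega)
      have h2 : (ρ * (ρ + z) + 1) * 2 ≤ (ρ * (ρ + z) + 1) * c := Nat.mul_le_mul_left _ hc2
      have h3 : (ρ * (ρ + (x + z)) + 1) * c = ρ * (x * c) + (ρ * (ρ + z) + 1) * c := by ring
      have h4 : 1 * (ρ + z) ≤ ρ * (ρ + z) := Nat.mul_le_mul_right _ hρ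
      omega
  · rw [hTc, hT.1]
    rcases hcase with ⟨rfl, rfl⟩ | hc2
    · have h1 : d + (ρ + 1) - 1 = d + ρ := by omega
      rw [h1]
      nlinarith
    · have h1 : d + (ρ + 1) - 1 = d + ρ := by omega
      rw [h1]
      have h2 : (ρ * (ρ + t) + 1) * c ≤ (W + 1) * c := Nat.mul_le_mul_right _ (by omega)
      have h3 : (ρ * ρ + 1) * 2 ≤ (ρ * ρ + 1) * c := Nat.mul_le_mul_left _ hc2
      have h4 : ρ * E ≤ ρ * (t * c) := Nat.mul_le_mul_left _ e4
      nlinarith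

theorem exists_sub_excess {T : Multiset ℕ} (hT : ∀ a ∈ T, 1 ≤ a) {v : ℕ}
    (hv : v + 1 ≤ Multiset.card T) (hv' : v ≤ excess T) :
    ∃ U R, T = U + R ∧ Multiset.card U = v + 1 ∧ v ≤ excess U := by
  obtain ⟨qs, f, rfl, hq⟩ := exists_split_ones hT
  by_cases h : v + 1 ≤ Multiset.card qs
  · obtain ⟨U, R, rfl, hU⟩ := exists_sub_card h
    have := card_le_excess fun q hq' => hq q (Multiset.mem_add.2 (Or.inl hq'))
    exact ⟨U, R + Multiset.replicate f 1, by rw [add_assoc], hU, by omega⟩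
  · rw [Multiset.card_add, Multiset.card_replicate] at hv
    obtain ⟨g, rfl⟩ : ∃ g, f = (v + 1 - Multiset.card qs) + g :=
      ⟨f - (v + 1 - Multiset.card qs), by omega⟩
    refine ⟨qs + Multiset.replicate (v + 1 - Multiset.card qs) 1, Multiset.replicate g 1,
      by rw [add_assoc, ← Multiset.replicate_add], ?_, by simpa using hv'⟩
    rw [Multiset.card_add, Multiset.card_replicate]
    omega

theorem transFac_of_excess {d : ℕ} (n : ℕ) : ∀ {L : List (Multiset ℕ)} {T : Multiset ℕ},
    L.length = n → (T.sum = d ∧ ∀ a ∈ T, 1 ≤ a) → 1 ≤ Multiset.card T →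
    (∀ P ∈ L, (P.sum = d ∧ ∀ a ∈ P, 1 ≤ a) ∧ 1 ≤ excess P ∧ excess P + Multiset.card T ≤ d) →
    (L.map excess).sum + 2 = d + Multiset.card T → Multiset.card T + 1 ≤ n → TransFac L T := by
  induction n with
  | zero => intros; omega
  | succ n ih =>
  intro L T hn hT hT1 hL hsum hlen
  have hTe := excess_add_card hT.2
  have herase : ∀ {P : Multiset ℕ} {L : List (Multiset ℕ)}, P ∈ L →
      (L.map excess).sum = excess P + ((L.erase P).map excess).sum := fun h => by
    simpa using ((List.perm_cons_erase h).map excess).sum_eq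
  by_cases hT2 : Multiset.card T = 1
  · obtain ⟨a, rfl⟩ := Multiset.card_eq_one.1 hT2
    obtain ⟨rfl, ha⟩ : a = d ∧ 1 ≤ a := by simpa using hT
    exact transFac_singleton ha L (fun P hP => (hL P hP).1) (by omega)
  by_cases hsmall : ∃ P ∈ L, excess P + 1 ≤ Multiset.card T
  · obtain ⟨P, hPL, hP⟩ := hsmall
    obtain ⟨⟨hPd, hP1⟩, hPv, hPT⟩ := hL P hPL
    obtain ⟨U, R, rfl, hU, hUv⟩ := exists_sub_excess hT.2 hP (by omega)
    rw [Multiset.sum_add] at *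
    have hU1 : ∀ a ∈ U, 1 ≤ a := fun a ha => hT.2 a (Multiset.mem_add.2 (Or.inl ha))
    have hUe := excess_add_card hU1
    obtain ⟨B, rfl⟩ := excess_le (E := R.sum) hP1 (by omega)
    refine TransFac.perm (L := (B + Multiset.replicate R.sum 1) ::
      L.erase (B + Multiset.replicate R.sum 1)) ?_ (List.perm_cons_erase hPL).symm
    have hs := herase hPL
    have hl := List.length_erase_of_mem hPL
    rw [Multiset.card_add] at *
    simp only [Multiset.sum_add, Multiset.sum_replicate, smul_eq_mul, mul_one, excess_add,
      excess_replicate_one, add_zero] at hPd hPv hPT hU hUv hs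
    refine TransFac.attach (N := U.sum) (by omega)
      ⟨by omega, fun a ha => hP1 a (Multiset.mem_add.2 (Or.inl ha))⟩ ⟨rfl, hU1⟩ (by omega)
      (ih (by omega) ⟨by simpa using hT.1, fun a ha => ?_⟩ (by simp) (fun Q hQ => ?_) ?_ ?_)
    · rcases Multiset.mem_cons.1 ha with rfl | ha
      · omega
      · exact hT.2 a (Multiset.mem_add.2 (Or.inr ha))
    · obtain ⟨h1, h2, h3⟩ := hL Q (List.mem_of_mem_erase hQ)
      exact ⟨h1, h2, by rw [Multiset.card_cons]; omega⟩
    · rw [Multiset.card_cons]; omega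
    · rw [Multiset.card_cons]; omega
  · push Not at hsmall
    obtain ⟨P, hP, hPmin⟩ := L.toFinset.exists_min_image excess
      ⟨L.head (List.ne_nil_of_length_pos (by omega)), by simp⟩
    rw [List.mem_toFinset] at hP
    have hl := List.length_erase_of_mem hP
    obtain ⟨Pm, hPm, hPmax⟩ := (L.erase P).toFinset.exists_max_image excess
      ⟨(L.erase P).head (List.ne_nil_of_length_pos (by omega)), by simp⟩
    rw [List.mem_toFinset] at hPm
    have hl' := List.length_erase_of_mem hPm
    have hs := herase hP
    have hs' := herase hPm
    have hPs := hsmall P hP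
    refine TransFac.perm
      (transFac_of_le_excess (d := d) (ρ := Multiset.card T - 1) (t := excess P + 1 - Multiset.card T)
        (by omega) (by omega) hT (by omega) (hL P hP).1 (by omega)
        (hL Pm (List.mem_of_mem_erase hPm)).1 ?_ (fun Q hQ => ?_) (by omega) (by omega))
      ((List.perm_cons_erase hP).trans ((List.perm_cons_erase hPm).cons P)).symm
    · have := hPmin Pm (List.mem_toFinset.2 (List.mem_of_mem_erase hPm))
      omega
    · have hQ1 := List.mem_of_mem_erase hQ
      have h1 := hPmin Q (List.mem_toFinset.2 (List.mem_of_mem_erase hQ1))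
      have h2 := hPmax Q (List.mem_toFinset.2 hQ1)
      exact ⟨(hL Q (List.mem_of_mem_erase hQ1)).1, by omega, h2⟩

/-- The product `h (s - 1) * ⋯ * h 0`. -/
def descProd {X : Type} (h : ℕ → Perm X) : ℕ → Perm X
  | 0 => 1
  | s + 1 => h s * descProd h s

/-- The permutation `(s, x) ↦ (s + 1, h s x)` of `Fin (n + 1) × X`. -/
def twist {X : Type} (n : ℕ) (h : ℕ → Perm X) : Perm (Fin (n + 1) × X) :=
  Equiv.prodShear (finRotate (n + 1)) fun s => h s

theorem twist_apply_of_lt {X : Type} {n : ℕ} (h : ℕ → Perm X) {s : ℕ} (hs : s < n) (x : X) :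
    twist n h (⟨s, by omega⟩, x) = (⟨s + 1, by omega⟩, h s x) := by
  ext1
  · exact finRotate_of_lt hs
  · rfl

theorem twist_apply_last {X : Type} {n : ℕ} (h : ℕ → Perm X) (x : X) :
    twist n h (Fin.last n, x) = (0, h n x) := by
  ext1
  · exact finRotate_last
  · rfl

theorem sameCycle_twist_zero {X : Type} {n : ℕ} (h : ℕ → Perm X) (s : ℕ) (hs : s < n + 1) (x : X) :
    (twist n h).SameCycle (0, x) (⟨s, hs⟩, descProd h s x) := by
  induction s with
  | zero => exact SameCycle.refl _ _
  | succ s ih =>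
    have h1 := ih (by omega)
    rw [← sameCycle_apply_right, twist_apply_of_lt h (by omega)] at h1
    exact h1

theorem sameCycle_twist {X : Type} {n : ℕ} (h : ℕ → Perm X) (a b : Fin (n + 1) × X) :
    (twist n h).SameCycle a b ↔
      (descProd h (n + 1)).SameCycle ((descProd h a.1)⁻¹ a.2) ((descProd h b.1)⁻¹ b.2) := by
  have base : ∀ a : Fin (n + 1) × X, (twist n h).SameCycle (0, (descProd h a.1)⁻¹ a.2) a := by
    rintro ⟨⟨s, hs⟩, x⟩
    have := sameCycle_twist_zero h s hs ((descProd h s)⁻¹ x)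
    simpa using this
  constructor
  · refine sameCycle_le (E := fun a b : Fin (n + 1) × X => (descProd h (n + 1)).SameCycle
      ((descProd h a.1)⁻¹ a.2) ((descProd h b.1)⁻¹ b.2))
      ⟨fun _ => SameCycle.refl _ _, SameCycle.symm, SameCycle.trans⟩ ?_
    rintro ⟨s, x⟩
    rcases Fin.eq_castSucc_or_eq_last s with ⟨⟨s, hs⟩, rfl⟩ | rfl
    · rw [show (Fin.castSucc ⟨s, hs⟩ : Fin (n + 1)) = ⟨s, by omega⟩ from rfl,
        twist_apply_of_lt h hs]
      simp [descProd]
    · have h1 : h n x = descProd h (n + 1) ((descProd h n)⁻¹ x) := by simp [descProd]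
      rw [twist_apply_last, h1]
      exact sameCycle_apply_right.2 (SameCycle.refl _ _)
  · intro hab
    have key : (twist n h).SameCycle (0, (descProd h a.1)⁻¹ a.2) (0, (descProd h b.1)⁻¹ b.2) := by
      refine sameCycle_le (σ := descProd h (n + 1))
        (E := fun x y => (twist n h).SameCycle (0, x) (0, y))
        ⟨fun _ => SameCycle.refl _ _, SameCycle.symm, SameCycle.trans⟩ (fun x => ?_) hab
      have h1 := sameCycle_twist_zero (n := n) h n (by omega) x
      rw [← sameCycle_apply_right] at h1
      have h2 := twist_apply_last (n := n) h (descProd h n x)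
      exact h2 ▸ h1
    exact ((base a).symm.trans key).trans (base b)

theorem ctype_twist {X : Type} [Fintype X] (n : ℕ) (h : ℕ → Perm X) :
    ctype (twist n h) = (ctype (descProd h (n + 1))).map ((n + 1) * ·) := by
  obtain ⟨ι, _, f, hf, hfc⟩ := exists_label (descProd h (n + 1))
  rw [ctype_eq_of_label _ f hf hfc,
    ctype_eq_of_label (twist n h) (fun a => f ((descProd h a.1)⁻¹ a.2))
      (fun i => (hf i).imp' (fun x => (0, x)) fun x hx => by simpa [descProd] using hx)
      (fun a b => (sameCycle_twist h a b).trans (hfc _ _)), Multiset.map_map]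
  refine Multiset.map_congr rfl fun i _ => ?_
  have e : {a : Fin (n + 1) × X // f ((descProd h a.1)⁻¹ a.2) = i} ≃
      Fin (n + 1) × {x // f x = i} :=
    { toFun := fun a => (a.1.1, ⟨(descProd h a.1.1)⁻¹ a.1.2, a.2⟩)
      invFun := fun b => ⟨(b.1, descProd h b.1 b.2.1), by simpa using b.2.2⟩
      left_inv := fun a => by simp
      right_inv := fun b => by simp }
  rw [Nat.card_congr e, Nat.card_prod, Nat.card_eq_fintype_card, Fintype.card_fin]
  rfl

/-- The permutation `(i, x) ↦ (i, β i x)` of `ι × X`. -/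
def fiberwise {ι X : Type} (β : ι → Perm X) : Perm (ι × X) := Equiv.prodShear (Equiv.refl ι) β

@[simp] theorem fiberwise_apply {ι X : Type} (β : ι → Perm X) (i : ι) (x : X) :
    fiberwise β (i, x) = (i, β i x) := rfl

theorem sameCycle_fiberwise {ι X : Type} (β : ι → Perm X) (a b : ι × X) :
    (fiberwise β).SameCycle a b ↔
      a.1 = b.1 ∧ (β a.1).SameCycle a.2 b.2 := by
  constructor
  · refine sameCycle_le (E := fun a b : ι × X => a.1 = b.1 ∧ (β a.1).SameCycle a.2 b.2)
      ⟨fun _ => ⟨rfl, SameCycle.refl _ _⟩, fun h => ⟨h.1.symm, h.1 ▸ h.2.symm⟩,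
        fun h h' => ⟨h.1.trans h'.1, h.2.trans (h.1.symm ▸ h'.2)⟩⟩ fun ⟨i, x⟩ => ?_
    simp
  · obtain ⟨i, x⟩ := a
    obtain ⟨j, y⟩ := b
    rintro ⟨rfl, h⟩
    refine sameCycle_le (σ := β i)
      (E := fun x y => (fiberwise β).SameCycle (i, x) (i, y))
      ⟨fun _ => SameCycle.refl _ _, SameCycle.symm, SameCycle.trans⟩ (fun x => ?_) h
    exact (sameCycle_apply_right (f := (fiberwise β))
      (x := (i, x)) (y := (i, x))).2 (SameCycle.refl _ _)

theorem ctype_fiberwise {ι X : Type} [Fintype ι] [Fintype X] (β : ι → Perm X) :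
    ctype (fiberwise β) = ∑ i, ctype (β i) := by
  choose κ hκ f hf hfc using fun i => exists_label (β i)
  rw [ctype_eq_of_label (ι := Σ i, κ i) _ (fun a : ι × X => ⟨a.1, f a.1 a.2⟩)
      (fun ⟨i, y⟩ => (hf i y).imp' (fun x => (i, x)) fun x hx => by simp [hx])
      (fun a b => (sameCycle_fiberwise β a b).trans ?_)]
  · rw [← Multiset.sum_map_singleton (Multiset.map _ _), Multiset.map_map]
    change ∑ a : (Σ i, κ i), _ = _
    rw [Fintype.sum_sigma]
    refine Finset.sum_congr rfl fun i _ => ?_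
    rw [ctype_eq_of_label _ (f i) (hf i) (hfc i),
      ← Multiset.sum_map_singleton (Multiset.map _ _), Multiset.map_map]
    refine Finset.sum_congr rfl fun y _ => ?_
    simp only [Function.comp_apply]
    congr 1
    refine Nat.card_congr
      { toFun := fun a => ⟨a.1.2, ?_⟩
        invFun := fun x => ⟨(i, x.1), by simp [x.2]⟩
        left_inv := ?_
        right_inv := fun x => by simp }
    · obtain ⟨⟨j, x⟩, h⟩ := a
      obtain ⟨rfl, h⟩ := Sigma.mk.inj_iff.1 h
      exact eq_of_heq h
    · rintro ⟨⟨j, x⟩, h⟩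
      obtain ⟨rfl, h'⟩ := Sigma.mk.inj_iff.1 h
      rfl
  · obtain ⟨i, x⟩ := a
    obtain ⟨j, y⟩ := b
    constructor
    · rintro ⟨h1, h2⟩
      obtain rfl : i = j := h1
      exact congrArg (Sigma.mk i) ((hfc i x y).1 h2)
    · intro h
      obtain ⟨rfl, h⟩ := Sigma.mk.inj_iff.1 h
      exact ⟨rfl, (hfc i x y).2 (eq_of_heq h)⟩

theorem fullCycleType_eq {d : ℕ} (σ : Perm (Fin d)) : fullCycleType σ = ctype σ := by
  rw [ctype_eq_cycleType, Fintype.card_fin, fullCycleType]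

theorem realizable_of_perm {Y : Type} [Fintype Y] {N k : ℕ} (hN : Fintype.card Y = N)
    (α : Fin k → Perm Y) (hprod : (List.ofFn α).prod = 1)
    (hconn : ∀ p : Y → Prop, (∀ i x, p (α i x) ↔ p x) → ∀ x y, p x → p y) :
    realizable N k fun i => ctype (α i) := by
  let e : Y ≃ Fin N := Fintype.equivFinOfCardEq hN
  let φ : Perm Y ≃* Perm (Fin N) := e.permCongrHom
  have hφ : ∀ σ y, φ σ (e y) = e (σ y) := fun σ y => by simp [φ]
  refine ⟨fun i => φ (α i), fun i => ?_, ?_, fun x y => ?_⟩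
  · rw [fullCycleType_eq]
    exact (ctype_congr e fun y => (hφ _ y).symm).symm
  · have : List.ofFn (fun i => φ (α i)) = (List.ofFn α).map φ := by
      rw [List.map_ofFn]; rfl
    rw [this, ← map_list_prod, hprod, map_one]
  · have key := hconn
      (fun z => ∃ g ∈ Subgroup.closure (Set.range fun i => φ (α i)), g x = e z) (fun i z => ?_)
      (e.symm x) (e.symm y) ⟨1, one_mem _, by simp⟩
    · simpa using key
    · have hi : φ (α i) ∈ Subgroup.closure (Set.range fun i => φ (α i)) :=
        Subgroup.subset_closure ⟨i, rfl⟩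
      constructor
      · rintro ⟨g, hg, h⟩
        refine ⟨(φ (α i))⁻¹ * g, mul_mem (inv_mem hi) hg, ?_⟩
        rw [Perm.mul_apply, h, ← hφ, ← Perm.mul_apply, inv_mul_cancel, Perm.one_apply]
      · rintro ⟨g, hg, h⟩
        exact ⟨φ (α i) * g, mul_mem hi hg, by rw [Perm.mul_apply, h, hφ]⟩

theorem descProd_congr {X : Type} {h h' : ℕ → Perm X} (n : ℕ) (hh : ∀ s < n, h s = h' s) :
    descProd h n = descProd h' n := by
  induction n with
  | zero => rfl
  | succ n ih => rw [descProd, descProd, hh n (by omega), ih fun s hs => hh s (by omega)]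

theorem descProd_one {X : Type} (n : ℕ) : descProd (fun _ => (1 : Perm X)) n = 1 := by
  induction n with
  | zero => rfl
  | succ n ih => rw [descProd, ih, one_mul]

theorem descProd_getD {X : Type} (l : List (Perm X)) :
    descProd (fun s => l.getD s 1) l.length = l.reverse.prod := by
  induction l using List.reverseRecOn with
  | nil => rfl
  | append_singleton l a ih =>
    rw [List.length_append, List.length_singleton, descProd,
      descProd_congr (h' := fun s => l.getD s 1) _ fun s hs => by
        simp [List.getElem?_append_left hs], ih]
    simp

theorem realizable_wreath {X : Type} [Fintype X] (n : ℕ) (g : Perm X) (β : ℕ → Perm X)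
    (hconn : ∀ p : X → Prop, (∀ x, p (g x) ↔ p x) → (∀ s < n + 1, ∀ x, p (β s x) ↔ p x) →
      ∀ x y, p x → p y) :
    realizable ((n + 1) * Fintype.card X) 3
      ![∑ s : Fin (n + 1), ctype (β s),
        (ctype (g * descProd β (n + 1))).map (fun a => (n + 1) * a),
        (ctype g).map (fun a => (n + 1) * a)] := by
  let γ : ℕ → Perm X := fun s => if s = n then g else 1
  let σ₁ : Perm (Fin (n + 1) × X) := fiberwise fun s => β s
  have hmul : twist n γ * σ₁ = twist n fun s => γ s * β s := by
    ext1 ⟨s, x⟩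
    rfl
  have hγ : descProd γ (n + 1) = g := by
    rw [descProd, descProd_congr n (h' := fun _ => 1) fun s hs => if_neg hs.ne, descProd_one]
    simp [γ]
  have hγβ : descProd (fun s => γ s * β s) (n + 1) = g * descProd β (n + 1) := by
    rw [descProd, descProd_congr n (h' := β) fun s hs => by simp [γ, hs.ne]]
    simp [γ, descProd, mul_assoc]
  have h := realizable_of_perm (k := 3) (N := (n + 1) * Fintype.card X) (by simp)
    ![σ₁, (twist n γ * σ₁)⁻¹, twist n γ] (by simp) ?_
  · convert h using 1
    funext i
    fin_cases i
    · exact (ctype_fiberwise fun s : Fin (n + 1) => β s).symm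
    · change _ = ctype (twist n γ * σ₁)⁻¹
      rw [ctype_inv, hmul, ctype_twist, hγβ]
      rfl
    · change _ = ctype (twist n γ)
      rw [ctype_twist, hγ]
      rfl
  · intro p hp
    have hp1 : ∀ s x, p (s, β s x) ↔ p (s, x) := fun s x => hp 0 (s, x)
    have hp0 : ∀ a, p (twist n γ a) ↔ p a := hp 2
    have hfib : ∀ s (hs : s < n + 1) x, p (⟨s, hs⟩, x) ↔ p (0, x) := by
      intro s
      induction s with
      | zero => intro _ x; rfl
      | succ s ih =>
        intro hs x
        rw [← ih (by omega), ← hp0 (⟨s, _⟩, x), twist_apply_of_lt γ (by omega)]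
        simp [γ, show s ≠ n by omega]
    have key := hconn (fun x => p (0, x)) (fun x => ?_) (fun s hs x => ?_)
    · rintro ⟨⟨s, hs⟩, x⟩ ⟨⟨t, ht⟩, y⟩ h
      exact (hfib t ht y).2 (key x y ((hfib s hs x).1 h))
    · have := hp0 (Fin.last n, x)
      rw [twist_apply_last] at this
      simp only [γ, if_true] at this
      exact this.trans (hfib n _ x)
    · exact (hfib s hs _).symm.trans ((hp1 ⟨s, hs⟩ x).trans (hfib s hs x))

theorem TransFac.realizable {P Q T : Multiset ℕ} {d : ℕ} {L M : List (Multiset ℕ)} (h : TransFac L T)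
    (hL : (L ++ [T]).Perm (P :: M ++ [Q])) (hM : M ≠ []) (hd : T.sum = d) :
    realizable (M.length * d) 3
      ![M.sum, Q.map (fun a => M.length * a), P.map (fun a => M.length * a)] := by
  obtain ⟨X, _, l, h1, h2, h3⟩ := h
  obtain ⟨l', h4, h5, h6⟩ := exists_list_reorder hL (l ++ [l.prod⁻¹]) (by simp [h1, ctype_inv, h2])
  simp only [List.prod_append, List.prod_singleton, mul_inv_cancel] at h5
  obtain ⟨g, l', rfl⟩ := List.exists_cons_of_ne_nil (l := l') (by rintro rfl; simp at h4)
  rw [List.map_cons, List.cons_append, List.cons.injEq, List.map_eq_append_iff] at h4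
  obtain ⟨hg, bs, l₂, rfl, hbs, hl₂⟩ := h4
  obtain ⟨a, rfl, ha⟩ := List.map_eq_singleton_iff.1 hl₂
  obtain ⟨n, hn⟩ : ∃ n, M.length = n + 1 :=
    ⟨M.length - 1, by have := List.length_pos_of_ne_nil hM; omega⟩
  have hbn : bs.reverse.length = n + 1 := by rw [List.length_reverse, ← hn, ← hbs, List.length_map]
  have hdesc := descProd_getD bs.reverse
  rw [hbn, List.reverse_reverse] at hdesc
  have hcard : Fintype.card X = d := by rw [← ctype_sum l.prod, h2, hd]
  have hgb : g * bs.prod = a⁻¹ := by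
    rw [eq_inv_iff_mul_eq_one, ← h5]
    simp [mul_assoc]
  have hsum : ∑ s : Fin (n + 1), ctype (bs.reverse.getD s 1) = M.sum := by
    rw [← hbs, ← List.sum_reverse, ← List.map_reverse, ← List.sum_ofFn]
    congr 1
    apply List.ext_getElem
    · rw [List.length_ofFn, List.length_map, hbn]
    · intro i hi hi'
      rw [List.getElem_ofFn, List.getElem_map, List.getD_eq_getElem _ _ (by simpa using hi')]
  have key := realizable_wreath n g (fun s => bs.reverse.getD s 1) fun p hp hp' x y => ?_
  · rwa [hsum, hdesc, hgb, ctype_inv, ha, hg, hcard, ← hn] at key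
  · refine h3 p (fun σ hσ => h6 p ?_ σ (by simp [hσ])) x y
    have hb : Stable bs p := by
      intro σ hσ
      obtain ⟨s, hs, rfl⟩ := List.getElem_of_mem (List.mem_reverse.2 hσ)
      have := hp' s (by omega)
      rwa [List.getD_eq_getElem _ _ hs] at this
    have hap : ∀ x, p (a x) ↔ p x := by
      have : ∀ x, p (a⁻¹ x) ↔ p x := fun x => by
        rw [← hgb, Perm.mul_apply, hp]
        exact hb.prod x
      intro x
      rw [← inv_inv a]
      exact iff_inv this x
    intro σ hσ
    simp only [List.mem_cons, List.mem_append, List.not_mem_nil, or_false] at hσ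
    rcases hσ with rfl | hσ | rfl
    · exact hp
    · exact hb σ hσ
    · exact hap

end Hurwitz

theorem stmt3 (k d : ℕ) (hk : 3 ≤ k) (hd : 3 ≤ d)
    (π : Fin k → Multiset ℕ)
    (hpart : ∀ i, (π i).sum = d ∧ (∀ a ∈ π i, 1 ≤ a) ∧ ∃ a ∈ π i, 1 < a)
    (hRH : ∑ i, (d - Multiset.card (π i)) = 2 * d - 2)
    (hmin : ∀ i, Multiset.card (π ⟨k - 1, by omega⟩) ≤ Multiset.card (π i))
    (hk2 : Multiset.card (π ⟨k - 1, by omega⟩) + 2 ≤ k)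
    (i j : Fin k) (hij : i ≠ j) :
    realizable ((k - 2) * d) 3
      ![∑ l ∈ Finset.univ \ {i, j}, π l,
        (π i).map (fun a => (k - 2) * a),
        (π j).map (fun a => (k - 2) * a)] := by
  set z : Fin k := ⟨k - 1, by omega⟩
  have hexc : ∀ l, Hurwitz.excess (π l) + Multiset.card (π l) = d := fun l =>
    (Hurwitz.excess_add_card (hpart l).2.1).trans (hpart l).1
  have hpos : ∀ l, 1 ≤ Hurwitz.excess (π l) := fun l => by
    obtain ⟨a, ha, ha1⟩ := (hpart l).2.2
    obtain ⟨R, hR⟩ := Multiset.exists_cons_of_mem ha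
    rw [hR, Hurwitz.excess_cons]
    omega
  have hsum : ∑ l, Hurwitz.excess (π l) = 2 * d - 2 := by
    rw [← hRH]
    exact Finset.sum_congr rfl fun l _ => by have := hexc l; omega
  rw [← Finset.add_sum_erase _ _ (Finset.mem_univ z)] at hsum
  have hfac : Hurwitz.TransFac ((Finset.univ.erase z).toList.map π) (π z) := by
    refine Hurwitz.transFac_of_excess (d := d) (k - 1) (by simp) ⟨(hpart z).1, (hpart z).2.1⟩ ?_ ?_ ?_
      (by omega)
    · obtain ⟨a, ha, -⟩ := (hpart z).2.2
      exact Multiset.card_pos_iff_exists_mem.2 ⟨a, ha⟩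
    · intro P hP
      obtain ⟨l, -, rfl⟩ := List.mem_map.1 hP
      have := hexc l
      have := hmin l
      exact ⟨⟨(hpart l).1, (hpart l).2.1⟩, hpos l, by omega⟩
    · rw [List.map_map, Finset.sum_map_toList]
      have := hexc z
      simp only [Function.comp_apply]
      omega
  have hcard : (Finset.univ \ {i, j} : Finset (Fin k)).card = k - 2 := by
    rw [← Finset.compl_eq_univ_sdiff, Finset.card_compl, Finset.card_pair hij, Fintype.card_fin]
  have hperm : ((Finset.univ.erase z).toList.map π ++ [π z]).Perm
      (π j :: (Finset.univ \ {i, j} : Finset (Fin k)).toList.map π ++ [π i]) := by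
    have h : ((Finset.univ.erase z).toList ++ [z]).Perm
        (j :: (Finset.univ \ {i, j} : Finset (Fin k)).toList ++ [i]) := by
      refine (List.perm_ext_iff_of_nodup ?_ ?_).2 fun x => ?_
      · simp [List.nodup_append, Finset.nodup_toList]
      · simp [List.nodup_append, Finset.nodup_toList, hij.symm]
        tauto
      · simp only [List.mem_append, List.mem_cons, Finset.mem_toList, Finset.mem_erase,
          Finset.mem_univ, Finset.mem_sdiff, Finset.mem_insert, Finset.mem_singleton,
          List.not_mem_nil]
        tauto
    simpa using h.map π
  have key := hfac.realizable hperm (by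
    intro h
    have := congrArg List.length h
    simp only [List.length_map, Finset.length_toList, List.length_nil] at this
    omega) (hpart z).1
  rwa [List.length_map, Finset.length_toList, hcard, Finset.sum_map_toList] at key
end

section
/- Let d ≥ 3 and k ≥ 3 be integers, and for i = 1, …, k let π_i = [b_{i1}, …, b_{iq_i}, 1, …, 1] (with e_i parts equal to 1) be nontrivial partitions of d, where b_{i1} ≥ b_{i2} ≥ … ≥ b_{iq_i} ≥ 2. Assume ∑_{i=1}^{k} ∑_{j=1}^{q_i} (b_{ij} − 1) = 2d − 2 and q_k + e_k ≤ q_i + e_i for all i = 1, …, k−1. If k ≥ q_k + e_k + 2 and q_1 ≥ q_i for all i = 2, …, k−1, then e_i ≥ 1 for all i = 2, …, k−1. -/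
theorem stmt4 (d k : ℕ) (hd : 3 ≤ d) (hk : 3 ≤ k)
    (q e : Fin k → ℕ) (b : Fin k → ℕ → ℕ)
    (hq : ∀ i, 1 ≤ q i)
    (hb2 : ∀ i : Fin k, ∀ j < q i, 2 ≤ b i j)
    (hmono : ∀ i : Fin k, ∀ j₁ j₂, j₁ ≤ j₂ → j₂ < q i → b i j₂ ≤ b i j₁)
    (hsum : ∀ i, (∑ j ∈ Finset.range (q i), b i j) + e i = d)
    (hRH : ∑ i, ∑ j ∈ Finset.range (q i), (b i j - 1) = 2 * d - 2)
    (hlen : ∀ i : Fin k, i.val < k - 1 →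
      q ⟨k - 1, by omega⟩ + e ⟨k - 1, by omega⟩ ≤ q i + e i)
    (hk2 : q ⟨k - 1, by omega⟩ + e ⟨k - 1, by omega⟩ + 2 ≤ k)
    (hq1 : ∀ i : Fin k, 0 < i.val → i.val < k - 1 → q i ≤ q ⟨0, by omega⟩) :
    ∀ i : Fin k, 0 < i.val → i.val < k - 1 → 1 ≤ e i := by
  intro i hi0 hik
  by_contra! he
  have hge (j : Fin k) : q j ≤ ∑ l ∈ Finset.range (q j), (b j l - 1) := by
    calc q j = ∑ l ∈ Finset.range (q j), 1 := by simp
      _ ≤ _ := Finset.sum_le_sum fun l hl => by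
        have := hb2 j l (Finset.mem_range.mp hl)
        omega
  have hdefect (j : Fin k) :
      (∑ l ∈ Finset.range (q j), (b j l - 1)) + q j + e j = d := by
    rw [← hsum j]
    congr 1
    calc (∑ l ∈ Finset.range (q j), (b j l - 1)) + q j
        = ∑ l ∈ Finset.range (q j), ((b j l - 1) + 1) := by simp [Finset.sum_add_distrib]
      _ = _ := Finset.sum_congr rfl fun l hl => by
        have := hb2 j l (Finset.mem_range.mp hl)
        omega
  set v : Fin k → ℕ := fun j => ∑ l ∈ Finset.range (q j), (b j l - 1)
  change ∑ j, v j = _ at hRH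
  change ∀ j, q j ≤ v j at hge
  change ∀ j, v j + q j + e j = d at hdefect
  let first : Fin k := ⟨0, by omega⟩
  let last : Fin k := ⟨k - 1, by omega⟩
  have h01 : first ≠ i := fun h => by simp [← h, first] at hi0
  have h12 : i ≠ last := fun h => by simp [h, last] at hik
  have h02 : first ≠ last := fun h => by
    have := congrArg Fin.val h
    simp only [first, last] at this
    omega
  let S : Finset (Fin k) := {first, i, last}
  have hS : ∑ j ∈ S, v j = v first + (v i + v last) := by
    rw [Finset.sum_insert (by simp [h01, h02]), Finset.sum_pair h12]
  have hcard : S.card = 3 := Finset.card_eq_three.mpr ⟨_, _, _, h01, h02, h12, rfl⟩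
  have hrest : k - 3 ≤ ∑ j ∈ Sᶜ, v j := by
    calc k - 3 = ∑ j ∈ Sᶜ, 1 := by simp [Finset.card_compl, hcard]
      _ ≤ _ := Finset.sum_le_sum fun j _ => (hq j).trans (hge j)
  have htotal := Finset.sum_add_sum_compl S v
  have hlast := hdefect last
  have hi := hdefect i
  have hfirst := hge first
  have hqi : q i ≤ q first := hq1 i hi0 hik
  change q last + e last + 2 ≤ k at hk2
  omega
end

section
/- Let d ≥ 3 and k ≥ 3 be integers, and for i = 1, …, k let π_i = [b_{i1}, …, b_{iq_i}, 1, …, 1] (with e_i parts equal to 1) be nontrivial partitions of d, where b_{i1} ≥ … ≥ b_{iq_i} ≥ 2, satisfying ∑_{i=1}^{k} ∑_{j=1}^{q_i} (b_{ij} − 1) = 2d − 2 and q_k + e_k ≤ q_i + e_i for all i = 1, …, k−1. Assume k ≥ q_k + e_k + 2, e_k = 0, and q_1 ≥ q_i for all i = 2, …, k−1. Then e_i ≥ 1 for i = 2, …, k−1, so one may define π̂_1 = [b_{11}, …, b_{1q_1} − 1, 1^{e_1}] (the last part ≥ 2 of π_1 decreased by 1), π̂_i = [b_{i1}, …, b_{iq_i},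 1^{e_i − 1}] for i = 2, …, k−1 (one part 1 removed), and π̂_k = [b_{k1} − 1, b_{k2}, …, b_{kq_k}]. If π̂_1 ≠ [1, …, 1], then: (1) π̂_1, …, π̂_k are k nontrivial partitions of d − 1; (2) ∑_{i=1}^{k} ((d−1) − |π̂_i|) = 2(d−1) − 2; and (3) q_k ≤ q_i + e_i for all i = 1, …, k−1. -/
theorem sum_parts (q : ℕ) (f : ℕ → ℕ) :
    (((List.range q).map f : List ℕ) : Multiset ℕ).sum = ∑ j ∈ Finset.range q, f j := rfl

theorem sum_parts_dec (q m : ℕ) (b : ℕ → ℕ) (hm : m < q) (hb : 1 ≤ b m) :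
    (((List.range q).map (fun j => if j = m then b j - 1 else b j) : List ℕ) : Multiset ℕ).sum + 1
      = ∑ j ∈ Finset.range q, b j := by
  have hmem := Finset.mem_range.2 hm
  rw [sum_parts, ← Finset.add_sum_erase _ _ hmem, ← Finset.add_sum_erase _ b hmem]
  have hrest : ∑ j ∈ (Finset.range q).erase m, (if j = m then b j - 1 else b j)
      = ∑ j ∈ (Finset.range q).erase m, b j :=
    Finset.sum_congr rfl fun j hj => if_neg (Finset.ne_of_mem_erase hj)
  rw [hrest, if_pos rfl]
  omega

theorem one_le_of_mem_parts_dec (q m : ℕ) (b : ℕ → ℕ) (hb : ∀ j < q, 2 ≤ b j) :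
    ∀ a ∈ (((List.range q).map (fun j => if j = m then b j - 1 else b j) : List ℕ) :
      Multiset ℕ), 1 ≤ a := by
  intro a ha
  simp only [Multiset.mem_coe, List.mem_map, List.mem_range] at ha
  obtain ⟨j, hj, rfl⟩ := ha
  have := hb j hj
  split_ifs <;> omega

theorem mem_parts (q : ℕ) (f : ℕ → ℕ) {j : ℕ} (hj : j < q) :
    f j ∈ (((List.range q).map f : List ℕ) : Multiset ℕ) := by
  simp only [Multiset.mem_coe, List.mem_map, List.mem_range]
  exact ⟨j, hj, rfl⟩


/-- The multiset of parts `b 0, …, b (q-1)` with the last part decreased by one. -/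
def partsDecLast (q : ℕ) (b : ℕ → ℕ) : Multiset ℕ :=
  ((List.range q).map (fun j => if j = q - 1 then b j - 1 else b j) : List ℕ)

/-- The multiset of parts `b 0, …, b (q-1)`. -/
def partsKeep (q : ℕ) (b : ℕ → ℕ) : Multiset ℕ :=
  ((List.range q).map b : List ℕ)

/-- The multiset of parts `b 0, …, b (q-1)` with the first part decreased by one. -/
def partsDecFirst (q : ℕ) (b : ℕ → ℕ) : Multiset ℕ :=
  ((List.range q).map (fun j => if j = 0 then b j - 1 else b j) : List ℕ)

theorem stmt5 (d k : ℕ) (hd : 3 ≤ d) (hk : 3 ≤ k)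
    (q e : Fin k → ℕ) (b : Fin k → ℕ → ℕ)
    (hq : ∀ i, 1 ≤ q i)
    (hb2 : ∀ i : Fin k, ∀ j < q i, 2 ≤ b i j)
    (hmono : ∀ i : Fin k, ∀ j₁ j₂, j₁ ≤ j₂ → j₂ < q i → b i j₂ ≤ b i j₁)
    (hsum : ∀ i, (∑ j ∈ Finset.range (q i), b i j) + e i = d)
    (hRH : ∑ i, ∑ j ∈ Finset.range (q i), (b i j - 1) = 2 * d - 2)
    (hlen : ∀ i : Fin k, i.val < k - 1 →
      q ⟨k - 1, by omega⟩ + e ⟨k - 1, by omega⟩ ≤ q i + e i)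
    (hk2 : q ⟨k - 1, by omega⟩ + e ⟨k - 1, by omega⟩ + 2 ≤ k)
    (hek : e ⟨k - 1, by omega⟩ = 0)
    (hq1 : ∀ i : Fin k, 0 < i.val → i.val < k - 1 → q i ≤ q ⟨0, by omega⟩)
    -- the partitions π̂ :
    (πhat : Fin k → Multiset ℕ)
    (hhat0 : πhat ⟨0, by omega⟩ =
      partsDecLast (q ⟨0, by omega⟩) (b ⟨0, by omega⟩) + Multiset.replicate (e ⟨0, by omega⟩) 1)
    (hhatmid : ∀ i : Fin k, 0 < i.val → i.val < k - 1 →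
      πhat i = partsKeep (q i) (b i) + Multiset.replicate (e i - 1) 1)
    (hhatk : πhat ⟨k - 1, by omega⟩ =
      partsDecFirst (q ⟨k - 1, by omega⟩) (b ⟨k - 1, by omega⟩))
    -- π̂_1 ≠ [1, …, 1] :
    (hne : ¬ (q ⟨0, by omega⟩ = 1 ∧ b ⟨0, by omega⟩ 0 = 2)) :
    (∀ i : Fin k, 0 < i.val → i.val < k - 1 → 1 ≤ e i) ∧
    (∀ i, (πhat i).sum = d - 1 ∧ (∀ a ∈ πhat i, 1 ≤ a) ∧ ∃ a ∈ πhat i, 1 < a) ∧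
    (∑ i, ((d - 1) - Multiset.card (πhat i)) = 2 * (d - 1) - 2) ∧
    (∀ i : Fin k, i.val < k - 1 → q ⟨k - 1, by omega⟩ ≤ q i + e i) := by
  set z : Fin k := ⟨0, by omega⟩ with hz
  set l : Fin k := ⟨k - 1, by omega⟩ with hl
  have hzl : z ≠ l := by simp only [hz, hl, ne_eq, Fin.mk.injEq]; omega
  have hval : ∀ i : Fin k, i ≠ z → i ≠ l → 0 < i.val ∧ i.val < k - 1 := by
    intro i h₁ h₂
    have h₃ := Fin.val_ne_of_ne h₁
    have h₄ := Fin.val_ne_of_ne h₂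
    have h₅ := i.isLt
    simp only [hz, hl] at h₃ h₄
    omega
  have hv : ∀ i, (∑ j ∈ Finset.range (q i), (b i j - 1)) + q i + e i = d := by
    intro i
    rw [← hsum i]
    congr 1
    have hsplit : ∑ j ∈ Finset.range (q i), b i j
        = ∑ j ∈ Finset.range (q i), ((b i j - 1) + 1) :=
      Finset.sum_congr rfl fun j hj => by
        have := hb2 i j (Finset.mem_range.1 hj)
        omega
    rw [hsplit, Finset.sum_add_distrib]
    simp
  have hvq : ∀ i, q i ≤ ∑ j ∈ Finset.range (q i), (b i j - 1) := by
    intro i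
    calc q i = ∑ j ∈ Finset.range (q i), 1 := by simp
      _ ≤ _ := Finset.sum_le_sum fun j hj => by
        have := hb2 i j (Finset.mem_range.1 hj)
        omega
  have he : ∀ i : Fin k, 0 < i.val → i.val < k - 1 → 1 ≤ e i := by
    intro i hi₀ hik
    by_contra h
    have hiz : i ≠ z := by intro h; simp [h, hz] at hi₀
    have hil : i ≠ l := by intro h; simp [h, hl] at hik
    have hrest : k - 3 ≤ ∑ x ∈ ((Finset.univ.erase z).erase l).erase i,
        ∑ j ∈ Finset.range (q x), (b x j - 1) := by
      calc k - 3 = ∑ x ∈ ((Finset.univ.erase z).erase l).erase i, 1 := by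
            rw [Finset.sum_const, Finset.card_erase_of_mem (by simp [hiz, hil]),
              Finset.card_erase_of_mem (by simp [hzl.symm]),
              Finset.card_erase_of_mem (Finset.mem_univ _), Finset.card_fin]
            simp; omega
        _ ≤ _ := Finset.sum_le_sum fun x _ => (hq x).trans (hvq x)
    rw [← Finset.add_sum_erase _ _ (Finset.mem_univ z),
      ← Finset.add_sum_erase _ _ (show l ∈ Finset.univ.erase z by simp [hzl.symm]),
      ← Finset.add_sum_erase _ _
        (show i ∈ (Finset.univ.erase z).erase l by simp [hiz, hil])] at hRH
    have h₁ := hq1 i hi₀ hik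
    have h₂ := hvq z
    have h₃ := hv i
    have h₄ := hv l
    omega
  have hcz : Multiset.card (πhat z) = q z + e z := by simp [hhat0, partsDecLast]
  have hcl : Multiset.card (πhat l) = q l := by simp [hhatk, partsDecFirst]
  have hcm : ∀ i : Fin k, 0 < i.val → i.val < k - 1 →
      Multiset.card (πhat i) = q i + (e i - 1) := by
    intro i h₁ h₂
    simp [hhatmid i h₁ h₂, partsKeep]
  refine ⟨he, ?_, ?_, fun i hi => by have := hlen i hi; omega⟩
  · intro i
    by_cases hiz : i = z
    · subst hiz
      have hqz := hq z
      rw [hhat0]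
      refine ⟨?_, ?_, ?_⟩
      · have h₁ := sum_parts_dec (q z) (q z - 1) (b z) (by omega)
          (one_le_two.trans (hb2 z _ (by omega)))
        have h₂ := hsum z
        rw [Multiset.sum_add, Multiset.sum_replicate, smul_eq_mul, partsDecLast]
        omega
      · intro a ha
        rcases Multiset.mem_add.1 ha with ha | ha
        · exact one_le_of_mem_parts_dec _ _ _ (hb2 z) a ha
        · exact (Multiset.eq_of_mem_replicate ha).ge
      · refine ⟨_, Multiset.mem_add.2 (Or.inl (mem_parts (q z) _ (j := 0) hqz)), ?_⟩
        have := hb2 z 0 hqz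
        split_ifs with h <;> omega
    · by_cases hil : i = l
      · subst hil
        have hql := hq l
        have h₂ := hsum l
        have h₃ := hb2 l 0 hql
        rw [hhatk]
        refine ⟨?_, one_le_of_mem_parts_dec _ _ _ (hb2 l), ?_⟩
        · have h₁ := sum_parts_dec (q l) 0 (b l) (by omega) (by omega)
          rw [partsDecFirst]
          omega
        · by_cases h : q l = 1
          · refine ⟨_, mem_parts (q l) _ (j := 0) hql, ?_⟩
            rw [h, Finset.sum_range_one] at h₂
            rw [if_pos rfl]
            omega
          · refine ⟨_, mem_parts (q l) _ (j := 1) (by omega), ?_⟩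
            rw [if_neg one_ne_zero]
            exact hb2 l 1 (by omega)
      · obtain ⟨h₀, hk₁⟩ := hval i hiz hil
        have hei := he i h₀ hk₁
        rw [hhatmid i h₀ hk₁]
        refine ⟨?_, ?_, ?_⟩
        · have h₂ := hsum i
          rw [Multiset.sum_add, Multiset.sum_replicate, smul_eq_mul, partsKeep, sum_parts]
          omega
        · intro a ha
          rcases Multiset.mem_add.1 ha with ha | ha
          · simp only [partsKeep, Multiset.mem_coe, List.mem_map, List.mem_range] at ha
            obtain ⟨j, hj, rfl⟩ := ha
            exact one_le_two.trans (hb2 i j hj)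
          · exact (Multiset.eq_of_mem_replicate ha).ge
        · exact ⟨_, Multiset.mem_add.2 (Or.inl (mem_parts (q i) _ (j := 0) (hq i))),
            hb2 i 0 (hq i)⟩
  · have hpt : ∀ i, ∑ j ∈ Finset.range (q i), (b i j - 1)
        = ((d - 1) - Multiset.card (πhat i)) + ((if i = z then 1 else 0)
          + (if i = l then 1 else 0)) := by
      intro i
      have h₁ := hv i
      have h₂ := hvq i
      have h₃ := hq i
      by_cases hiz : i = z
      · subst hiz
        rw [hcz, if_pos rfl, if_neg hzl]
        omega
      · by_cases hil : i = l
        · subst hil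
          rw [hcl, if_pos rfl, if_neg hiz]
          omega
        · obtain ⟨h₀, hk₁⟩ := hval i hiz hil
          have := he i h₀ hk₁
          rw [hcm i h₀ hk₁, if_neg hiz, if_neg hil]
          omega
    rw [Finset.sum_congr rfl fun i _ => hpt i, Finset.sum_add_distrib,
      Finset.sum_add_distrib] at hRH
    simp only [Finset.sum_ite_eq', Finset.mem_univ, if_true] at hRH
    omega
end

section
/- Let n be a positive integer and let I ⊆ ℝ be an interval. Suppose r, θ : I → ℝ are differentiable with r(t) > 0 for all t ∈ I, and satisfy the system r′(t) = sin((n+1)θ(t)) / (2 r(t)ⁿ) and θ′(t) = cos((n+1)θ(t)) / (2 r(t)^{n+1}) for all t ∈ I. Then the function t ↦ r(t)^{n+1} · cos((n+1)θ(t)) is constant on I. -/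
theorem stmt12 (n : ℕ) (hn : 1 ≤ n) (I : Set ℝ) (hI : I.OrdConnected)
    (r θ : ℝ → ℝ)
    (hr : ∀ t ∈ I, HasDerivWithinAt r
      (Real.sin (((n : ℝ) + 1) * θ t) / (2 * r t ^ n)) I t)
    (hθ : ∀ t ∈ I, HasDerivWithinAt θ
      (Real.cos (((n : ℝ) + 1) * θ t) / (2 * r t ^ (n + 1))) I t)
    (hpos : ∀ t ∈ I, 0 < r t) :
    ∀ t₁ ∈ I, ∀ t₂ ∈ I,
      r t₁ ^ (n + 1) * Real.cos (((n : ℝ) + 1) * θ t₁) =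
      r t₂ ^ (n + 1) * Real.cos (((n : ℝ) + 1) * θ t₂) := by
  have hderiv : ∀ t ∈ I, HasDerivWithinAt
      (fun t => r t ^ (n + 1) * Real.cos (((n : ℝ) + 1) * θ t)) 0 I t := by
    intro t ht
    have hrt := (hpos t ht).ne'
    refine (((hr t ht).fun_pow (n + 1)).fun_mul
      ((hθ t ht).const_mul ((n : ℝ) + 1)).cos).congr_deriv ?_
    simp only [Nat.add_sub_cancel]
    push_cast
    field_simp
    ring
  intro t₁ h₁ t₂ h₂
  have h := hI.convex.norm_image_sub_le_of_norm_hasDerivWithin_le hderiv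
    (fun _ _ => norm_zero.le) h₂ h₁
  rw [zero_mul] at h
  exact sub_eq_zero.mp (norm_le_zero_iff.mp h)
end

section
/- The collection D = {[3,2,1], [3,2,1], [2,2,1,1], [2,1,1,1,1], [2,1,1,1,1]} of five partitions of 6 is realizable: there exist permutations α_1, …, α_5 of {1, …, 6} whose cycle types (counting fixed points as parts equal to 1) are respectively [3,2,1], [3,2,1], [2,2,1,1], [2,1,1,1,1], [2,1,1,1,1], whose product α_1 ⋯ α_5 is the identity, and which generate a subgroup acting transitively on {1, …, 6}. -/
open Equiv in
/-- A product of a 3-cycle and a disjoint transposition has cycle type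
`[3, 2, 1]` on six points. -/
theorem fullCycleType_threeCycle_mul_swap {σ : Perm (Fin 6)} {a b : Fin 6} (hσ : σ.IsThreeCycle)
    (hab : a ≠ b) (h : σ.Disjoint (swap a b)) : fullCycleType (σ * swap a b) = {3, 2, 1} := by
  have hs : (swap a b).cycleType = {2} := Perm.isSwap_iff_cycleType.1 (Perm.swap_isSwap_iff.2 hab)
  rw [fullCycleType, h.cycleType_mul, hσ.cycleType, hs]
  decide

open Equiv in
/-- A product of two disjoint transpositions has cycle type `[2, 2, 1, 1]` on six points. -/
theorem fullCycleType_swap_mul_swap {a b c d : Fin 6} (hab : a ≠ b) (hcd : c ≠ d)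
    (h : (swap a b).Disjoint (swap c d)) :
    fullCycleType (swap a b * swap c d) = {2, 2, 1, 1} := by
  rw [fullCycleType, h.cycleType_mul, Perm.isSwap_iff_cycleType.1 (Perm.swap_isSwap_iff.2 hab),
    Perm.isSwap_iff_cycleType.1 (Perm.swap_isSwap_iff.2 hcd)]
  decide

open Equiv in
/-- A transposition has cycle type `[2, 1, 1, 1, 1]` on six points. -/
theorem fullCycleType_swap {a b : Fin 6} (hab : a ≠ b) :
    fullCycleType (swap a b) = {2, 1, 1, 1, 1} := by
  rw [fullCycleType, Perm.isSwap_iff_cycleType.1 (Perm.swap_isSwap_iff.2 hab)]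
  decide

/-- A subgroup of permutations that moves one point to every other point is transitive. -/
theorem exists_mem_apply_eq_of_forall_exists {X : Type*} {H : Subgroup (Equiv.Perm X)} {x₀ : X}
    (h : ∀ x, ∃ g ∈ H, g x₀ = x) (x y : X) : ∃ g ∈ H, g x = y := by
  obtain ⟨g, hg, rfl⟩ := h x
  obtain ⟨k, hk, rfl⟩ := h y
  exact ⟨k * g⁻¹, H.mul_mem hk (H.inv_mem hg), by simp⟩

theorem stmt15 :
    ∃ α₁ α₂ α₃ α₄ α₅ : Equiv.Perm (Fin 6),
      fullCycleType α₁ = {3, 2, 1} ∧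
      fullCycleType α₂ = {3, 2, 1} ∧
      fullCycleType α₃ = {2, 2, 1, 1} ∧
      fullCycleType α₄ = {2, 1, 1, 1, 1} ∧
      fullCycleType α₅ = {2, 1, 1, 1, 1} ∧
      α₁ * α₂ * α₃ * α₄ * α₅ = 1 ∧
      ∀ x y : Fin 6, ∃ g ∈ Subgroup.closure {α₁, α₂, α₃, α₄, α₅}, g x = y := by
  open Equiv in
  refine ⟨swap 0 1 * swap 1 2 * swap 3 4, swap 1 2 * swap 0 1 * swap 3 4, swap 2 3 * swap 4 5,
    swap 2 3, swap 4 5, fullCycleType_threeCycle_mul_swap ?_ (by decide) ?_,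
    fullCycleType_threeCycle_mul_swap ?_ (by decide) ?_,
    fullCycleType_swap_mul_swap (by decide) (by decide) ?_,
    fullCycleType_swap (by decide), fullCycleType_swap (by decide), by decide, ?_⟩
  · rw [swap_comm 0 1]
    exact Perm.isThreeCycle_swap_mul_swap_same (by decide) (by decide) (by decide)
  · unfold Perm.Disjoint; decide
  · rw [swap_comm 0 1, ← Perm.IsThreeCycle.inv_iff, mul_inv_rev, swap_inv, swap_inv]
    exact Perm.isThreeCycle_swap_mul_swap_same (by decide) (by decide) (by decide)
  · unfold Perm.Disjoint; decide
  · unfold Perm.Disjoint; decide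
  · generalize hH : Subgroup.closure (G := Perm (Fin 6)) _ = H
    have ha : swap 0 1 * swap 1 2 * swap 3 4 ∈ H := hH ▸ Subgroup.subset_closure (by simp)
    have hs : swap 2 3 ∈ H := hH ▸ Subgroup.subset_closure (by simp)
    have ht : swap 4 5 ∈ H := hH ▸ Subgroup.subset_closure (by simp)
    have h₂ := H.mul_mem ha ha
    have h₃ := H.mul_mem hs h₂
    have h₄ := H.mul_mem ha h₃
    have h₅ := H.mul_mem ht h₄
    refine exists_mem_apply_eq_of_forall_exists (x₀ := 0) fun x => ?_
    fin_cases x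
    exacts [⟨1, H.one_mem, rfl⟩, ⟨_, ha, by decide⟩, ⟨_, h₂, by decide⟩, ⟨_, h₃, by decide⟩,
      ⟨_, h₄, by decide⟩, ⟨_, h₅, by decide⟩]
end

section
/- The collection D = {[4,1,1], [3,2,1], [2,2,1,1], [2,1,1,1,1], [2,1,1,1,1]} of five partitions of 6 is realizable: there exist permutations α_1, …, α_5 of {1, …, 6} whose cycle types (counting fixed points as parts equal to 1) are respectively [4,1,1], [3,2,1], [2,2,1,1], [2,1,1,1,1], [2,1,1,1,1], whose product α_1 ⋯ α_5 is the identity, and which generate a subgroup acting transitively on {1, …, 6}. -/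
open Equiv Equiv.Perm

theorem cycleType_formPerm_of_nodup {α : Type*} [Fintype α] [DecidableEq α] {l : List α}
    (hl : l.Nodup) (hn : 2 ≤ l.length) : l.formPerm.cycleType = {l.length} := by
  rw [(List.isCycle_formPerm hl hn).cycleType, List.support_formPerm_of_nodup l hl,
    List.toFinset_card_of_nodup hl]
  rintro x rfl
  simp at hn

theorem cycleType_formPerm_mul_formPerm {α : Type*} [Fintype α] [DecidableEq α] {l m : List α}
    (hl : l.Nodup) (hm : m.Nodup) (hl' : 2 ≤ l.length) (hm' : 2 ≤ m.length)
    (h : l.Disjoint m) :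
    (l.formPerm * m.formPerm).cycleType = {l.length, m.length} := by
  rw [((List.formPerm_disjoint_iff hl hm hl' hm').2 h).cycleType_mul,
    cycleType_formPerm_of_nodup hl hl', cycleType_formPerm_of_nodup hm hm']
  rfl

theorem stmt16 :
    ∃ α₁ α₂ α₃ α₄ α₅ : Equiv.Perm (Fin 6),
      fullCycleType α₁ = {4, 1, 1} ∧
      fullCycleType α₂ = {3, 2, 1} ∧
      fullCycleType α₃ = {2, 2, 1, 1} ∧
      fullCycleType α₄ = {2, 1, 1, 1, 1} ∧
      fullCycleType α₅ = {2, 1, 1, 1, 1} ∧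
      α₁ * α₂ * α₃ * α₄ * α₅ = 1 ∧
      ∀ x y : Fin 6, ∃ g ∈ Subgroup.closure {α₁, α₂, α₃, α₄, α₅}, g x = y := by
  let a : Perm (Fin 6) := [0, 1, 2, 3].formPerm
  let b : Perm (Fin 6) := [3, 4, 5].formPerm * [1, 2].formPerm
  refine ⟨a, b, [1, 3].formPerm * [4, 5].formPerm, [1, 4].formPerm, [0, 1].formPerm,
    ?_, ?_, ?_, ?_, ?_, by decide, fun x y ↦ ?_⟩
  · rw [fullCycleType, cycleType_formPerm_of_nodup (by decide) (by decide)]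
    decide
  · rw [fullCycleType, cycleType_formPerm_mul_formPerm (by decide) (by decide) (by decide)
      (by decide) (by simp)]
    decide
  · rw [fullCycleType, cycleType_formPerm_mul_formPerm (by decide) (by decide) (by decide)
      (by decide) (by simp)]
    decide
  · rw [fullCycleType, cycleType_formPerm_of_nodup (by decide) (by decide)]
    decide
  · rw [fullCycleType, cycleType_formPerm_of_nodup (by decide) (by decide)]
    decide
  · have word (z : Fin 6) : ∃ i : Fin 4, ∃ j : Fin 3, (b ^ (j : ℕ) * a ^ (i : ℕ)) 0 = z := by
      revert z
      decide
    obtain ⟨i, j, hx⟩ := word x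
    obtain ⟨k, l, hy⟩ := word y
    have mem (i j : ℕ) : b ^ j * a ^ i ∈ Subgroup.closure
        {a, b, [1, 3].formPerm * [4, 5].formPerm, [1, 4].formPerm, [0, 1].formPerm} :=
      mul_mem (pow_mem (Subgroup.subset_closure (by simp)) _)
        (pow_mem (Subgroup.subset_closure (by simp)) _)
    refine ⟨_, mul_mem (mem k l) (inv_mem (mem i j)), ?_⟩
    rw [Perm.mul_apply, Perm.inv_eq_iff_eq.2 hx.symm, hy]
end

section
/- The collection D = {[4,2,2], [4,2,2], [2,2,1,1,1,1], [2,1,1,1,1,1,1], [2,1,1,1,1,1,1]} of five partitions of 8 is realizable: there exist permutations α_1, …, α_5 of {1, …, 8} whose cycle types (counting fixed points as parts equal to 1) are respectively [4,2,2], [4,2,2], [2,2,1⁴], [2,1⁶], [2,1⁶], whose product α_1 ⋯ α_5 is the identity, and which generate a subgroup acting transitively on {1, …, 8}. -/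
open Equiv.Perm in
/-- The cycle type of a product of disjoint cycles given by lists without repetition. -/
theorem cycleType_prod_formPerm {α : Type*} [Fintype α] [DecidableEq α] (L : List (List α))
    (hlen : ∀ l ∈ L, l.Nodup ∧ 2 ≤ l.length) (hdisj : L.Pairwise List.Disjoint) :
    (L.map List.formPerm).prod.cycleType = (L.map List.length : Multiset ℕ) := by
  rw [cycleType_eq (L.map List.formPerm) rfl]
  · simp only [List.map_map, Multiset.coe_eq_coe]
    refine .of_eq (List.map_congr_left fun l hl => ?_)
    obtain ⟨hn, h2⟩ := hlen l hl
    rw [Function.comp_apply, Function.comp_apply, List.support_formPerm_of_nodup l hn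
      (by rintro x rfl; simp at h2), List.toFinset_card_of_nodup hn]
  · simp only [List.mem_map, forall_exists_index, and_imp, forall_apply_eq_imp_iff₂]
    exact fun l hl => List.isCycle_formPerm (hlen l hl).1 (hlen l hl).2
  · rw [List.pairwise_map]
    refine hdisj.imp_of_mem fun {a b} ha hb h => ?_
    exact (List.formPerm_disjoint_iff (hlen a ha).1 (hlen b hb).1 (hlen a ha).2 (hlen b hb).2).2 h

/-- The full cycle type of a product of disjoint cycles in `Fin d` given by lists. -/
theorem fullCycleType_prod_formPerm {d : ℕ} (L : List (List (Fin d)))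
    (hlen : ∀ l ∈ L, l.Nodup ∧ 2 ≤ l.length) (hdisj : L.Pairwise List.Disjoint) :
    fullCycleType (L.map List.formPerm).prod =
      (L.map List.length : Multiset ℕ) +
        Multiset.replicate (d - (L.map List.length).sum) 1 := by
  rw [fullCycleType, cycleType_prod_formPerm L hlen hdisj, Multiset.sum_coe]

theorem stmt17 :
    ∃ α₁ α₂ α₃ α₄ α₅ : Equiv.Perm (Fin 8),
      fullCycleType α₁ = {4, 2, 2} ∧
      fullCycleType α₂ = {4, 2, 2} ∧
      fullCycleType α₃ = {2, 2, 1, 1, 1, 1} ∧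
      fullCycleType α₄ = {2, 1, 1, 1, 1, 1, 1} ∧
      fullCycleType α₅ = {2, 1, 1, 1, 1, 1, 1} ∧
      α₁ * α₂ * α₃ * α₄ * α₅ = 1 ∧
      ∀ x y : Fin 8, ∃ g ∈ Subgroup.closure {α₁, α₂, α₃, α₄, α₅}, g x = y := by
  let P (L : List (List (Fin 8))) : Equiv.Perm (Fin 8) := (L.map List.formPerm).prod
  let a := P [[7, 5, 1, 2], [6, 0], [4, 3]]
  let b := P [[0, 4, 3, 6], [1, 2], [5, 7]]
  let c := P [[0, 3], [2, 4]]
  refine ⟨a, b, c, P [[1, 7]], P [[4, 2]],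
    (fullCycleType_prod_formPerm _ (by decide) (by simp [List.Disjoint])).trans (by decide),
    (fullCycleType_prod_formPerm _ (by decide) (by simp [List.Disjoint])).trans (by decide),
    (fullCycleType_prod_formPerm _ (by decide) (by simp [List.Disjoint])).trans (by decide),
    (fullCycleType_prod_formPerm _ (by decide) (by simp)).trans (by decide),
    (fullCycleType_prod_formPerm _ (by decide) (by simp)).trans (by decide),
    by decide, fun x y => ?_⟩
  have reach : ∀ z, ∃ i : Fin 4, ∃ j : Fin 2, ∃ k : Fin 4,
      (a ^ (k : ℕ) * c ^ (j : ℕ) * b ^ (i : ℕ)) 0 = z := by decide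
  set H := Subgroup.closure {a, b, c, P [[1, 7]], P [[4, 2]]}
  have ha : a ∈ H := Subgroup.subset_closure (by simp)
  have hb : b ∈ H := Subgroup.subset_closure (by simp)
  have hc : c ∈ H := Subgroup.subset_closure (by simp)
  have orbit : ∀ z, ∃ g ∈ H, g 0 = z := fun z =>
    let ⟨_, _, _, h⟩ := reach z
    ⟨_, mul_mem (mul_mem (pow_mem ha _) (pow_mem hc _)) (pow_mem hb _), h⟩
  obtain ⟨g, hg, rfl⟩ := orbit x
  obtain ⟨h, hh, rfl⟩ := orbit y
  exact ⟨h * g⁻¹, mul_mem hh (inv_mem hg), by simp⟩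
end
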